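/- arXiv:1112.2916 — 2 statements merged into one kernel-verified Lean document; each statement's English description precedes it below -/
import Mathlib

section
/- Let v = (v₁, v₂, v₃, v₄) ∈ ℂ⁴ with v₁ + v₂ + v₃ + v₄ = 0. The following are equivalent: (i) for every differential field extension L of ℂ(t), every differential subfield K of L, and every pair (y, x) ∈ L² satisfying the system S_V(v): t·y' = 2y²x − 2yx + ty² − ty + (v₁−v₂−v₃+v₄)y + (v₂−v₁) and t·x' = −2yx² + x² − 2txy + tx − (v₁−v₂−v₃+v₄)x + (v₃−v₁)t, either y and x are both algebraic over K, or y, x are algebraically independent over K; (ii) vᵢ − vⱼ ∉ ℤ for all 1 ≤ i < j ≤ 4. (Corollary 3.14: the solution set of S_V(v) is strongly minimal if and only if v does not lie in the exceptional set 𝒲 of parameters with some integer difference vᵢ − vⱼ.) -/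
namespace PainleveV

open Polynomial

noncomputable section

section

/-- The derivation of `R[X]` acting coefficientwise through a derivation of `R`. -/
def coeffDer {R : Type*} [CommRing R] (d : Derivation ℤ R R) : Derivation ℤ R[X] R[X] :=
  letI : Differential R := ⟨d⟩
  Differential.mapCoeffs

lemma coeff_coeffDer {R : Type*} [CommRing R] (d : Derivation ℤ R R) (p : R[X]) (i : ℕ) :
    (coeffDer d p).coeff i = d (p.coeff i) :=
  letI : Differential R := ⟨d⟩
  Differential.coeff_mapCoeffs p i

lemma coeffDer_C {R : Type*} [CommRing R] (d : Derivation ℤ R R) (r : R) :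
    coeffDer d (C r) = C (d r) :=
  letI : Differential R := ⟨d⟩
  Differential.mapCoeffs_C r

lemma coeffDer_X {R : Type*} [CommRing R] (d : Derivation ℤ R R) :
    coeffDer d (X : R[X]) = 0 :=
  letI : Differential R := ⟨d⟩
  Differential.mapCoeffs_X

/-- The derivation `d/dX` of `R[X]`, with values forgotten to `ℤ`-linearity. -/
def polyDer (R : Type*) [CommRing R] : Derivation ℤ R[X] R[X] :=
  (derivative' (R := R)).restrictScalars ℤ

lemma polyDer_apply {R : Type*} [CommRing R] (p : R[X]) : polyDer R p = derivative p := rfl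

variable {K : Type*} [Field K]

/-- The derivation of `K[y][x]` acting as `s • δ` on constants, with `y ↦ P` and `x ↦ Q`. -/
def vectorField (δ : Derivation ℤ K K) (s P Q : K[X][X]) : Derivation ℤ K[X][X] K[X][X] :=
  s • coeffDer (coeffDer δ) + P • coeffDer (polyDer K) + Q • polyDer K[X]

lemma vectorField_C (δ : Derivation ℤ K K) (s P Q : K[X][X]) (f : K[X]) :
    vectorField δ s P Q (C f) = s * C (coeffDer δ f) + P * C (derivative f) := by
  change s * coeffDer (coeffDer δ) (C f) + P * coeffDer (polyDer K) (C f) + Q * derivative (C f) = _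
  rw [show coeffDer (coeffDer δ) (C f) = C (coeffDer δ f) from coeffDer_C _ _,
    show coeffDer (polyDer K) (C f) = C (derivative f) from coeffDer_C _ _]
  simp

lemma vectorField_C_C (δ : Derivation ℤ K K) (s P Q : K[X][X]) (c : K) :
    vectorField δ s P Q (C (C c)) = s * C (C (δ c)) := by
  simp [vectorField_C, coeffDer_C]

lemma vectorField_C_X (δ : Derivation ℤ K K) (s P Q : K[X][X]) :
    vectorField δ s P Q (C X) = P := by
  simp [vectorField_C, coeffDer_X]

lemma vectorField_X (δ : Derivation ℤ K K) (s P Q : K[X][X]) :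
    vectorField δ s P Q X = Q := by
  change s * coeffDer (coeffDer δ) X + P * coeffDer (polyDer K) X + Q * derivative X = _
  rw [show coeffDer (coeffDer δ) X = 0 from coeffDer_X _,
    show coeffDer (polyDer K) X = 0 from coeffDer_X _]
  simp

lemma bivariate_induction {R : Type*} [CommRing R] {p : R[X][X] → Prop}
    (hadd : ∀ F G, p F → p G → p (F + G)) (hmul : ∀ F G, p F → p G → p (F * G))
    (hC : ∀ c, p (C (C c))) (hy : p (C X)) (hx : p X) (F : R[X][X]) : p F := by
  have hC' : ∀ f : R[X], p (C f) := by
    intro f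
    induction f using Polynomial.induction_on with
    | C a => exact hC a
    | add f g hf hg => rw [C_add]; exact hadd _ _ hf hg
    | monomial n a h => rw [pow_succ, ← mul_assoc, C_mul]; exact hmul _ _ h hy
  induction F using Polynomial.induction_on with
  | C a => exact hC' a
  | add f g hf hg => exact hadd _ _ hf hg
  | monomial n a h => rw [pow_succ, ← mul_assoc]; exact hmul _ _ h hx

lemma intertwine {B : Type*} [CommRing B] [Algebra ℤ B] (φ : K[X][X] →+* B)
    (D₁ : Derivation ℤ K[X][X] K[X][X]) (D₂ : Derivation ℤ B B)
    (hC : ∀ c, φ (D₁ (C (C c))) = D₂ (φ (C (C c)))) (hy : φ (D₁ (C X)) = D₂ (φ (C X)))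
    (hx : φ (D₁ X) = D₂ (φ X)) (F : K[X][X]) : φ (D₁ F) = D₂ (φ F) := by
  induction F using bivariate_induction with
  | hadd F G hF hG => simp [hF, hG]
  | hmul F G hF hG => simp [hF, hG]
  | hC c => exact hC c
  | hy => exact hy
  | hx => exact hx

/-- `t · y'` along the system, as a polynomial in `y` and `x`. -/
def fieldY (t a b : K) : K[X][X] :=
  2 * C X ^ 2 * X - 2 * C X * X + C (C t) * C X ^ 2 - C (C t) * C X + C (C a) * C X + C (C b)

/-- `t · x'` along the system, as a polynomial in `y` and `x`. -/
def fieldX (t a e : K) : K[X][X] :=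
  -((2 : K[X][X]) * C X * X ^ 2) + X ^ 2 - 2 * C (C t) * X * C X + C (C t) * X - C (C a) * X + C (C (e * t))

/-- The derivation of `K[y][x]` defined by the system, multiplied by `t`. -/
def sysDer (δ : Derivation ℤ K K) (t a b e : K) : Derivation ℤ K[X][X] K[X][X] :=
  vectorField δ 1 (fieldY t a b) (fieldX t a e)

lemma sysDer_C_C (δ : Derivation ℤ K K) (t a b e c : K) :
    sysDer δ t a b e (C (C c)) = C (C (δ c)) := by simp [sysDer, vectorField_C_C]

lemma sysDer_C_X (δ : Derivation ℤ K K) (t a b e : K) :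
    sysDer δ t a b e (C X) = fieldY t a b := vectorField_C_X ..

lemma sysDer_X (δ : Derivation ℤ K K) (t a b e : K) :
    sysDer δ t a b e X = fieldX t a e := vectorField_X ..

variable {L : Type*} [Field L] [Algebra K L]

/-- Evaluation of a polynomial in `K[y][x]` at `(y, x)`. -/
def evalAt {A : Type*} [CommRing A] [Algebra K A] (y x : A) : K[X][X] →ₐ[K] A :=
  aevalAeval y x

@[simp]
lemma evalAt_C_C {A : Type*} [CommRing A] [Algebra K A] (y x : A) (c : K) :
    evalAt y x (C (C c)) = algebraMap K A c := by
  simp [evalAt]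

@[simp]
lemma evalAt_C_X {A : Type*} [CommRing A] [Algebra K A] (y x : A) :
    evalAt (K := K) y x (C X) = y := by
  simp [evalAt]

@[simp]
lemma evalAt_X {A : Type*} [CommRing A] [Algebra K A] (y x : A) :
    evalAt (K := K) y x X = x := by
  simp [evalAt]

/-- A solution `(y, x)` of the system with parameters `(a, b, e)`, written for the derivation
`η = t d/dt`, whose coordinates are not both algebraic over `K` but satisfy the algebraic
relation `F`. -/
structure DependentSolution (δ : Derivation ℤ K K) (η : Derivation ℤ L L) (t a b e : K)
    (y x : L) (F : K[X][X]) : Prop where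
  der_t : δ t = t
  t_ne : t ≠ 0
  der_a : δ a = 0
  der_b : δ b = 0
  der_e : δ e = 0
  der_y : η y = 2 * y ^ 2 * x - 2 * y * x + algebraMap K L t * y ^ 2 - algebraMap K L t * y
    + algebraMap K L a * y + algebraMap K L b
  der_x : η x = -(2 * y * x ^ 2) + x ^ 2 - 2 * algebraMap K L t * x * y + algebraMap K L t * x
    - algebraMap K L a * x + algebraMap K L (e * t)
  not_algebraic : ¬ (IsAlgebraic K y ∧ IsAlgebraic K x)
  ne_zero : F ≠ 0
  eval_eq_zero : evalAt y x F = 0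

section

variable {δ : Derivation ℤ K K} {η : Derivation ℤ L L} {t a b e : K} {y x : L} {F : K[X][X]}

lemma DependentSolution.evalAt_sysDer (hδ : ∀ k, η (algebraMap K L k) = algebraMap K L (δ k))
    (h : DependentSolution δ η t a b e y x F) (H : K[X][X]) :
    evalAt y x (sysDer δ t a b e H) = η (evalAt y x H) := by
  refine intertwine (evalAt y x : K[X][X] →ₐ[K] L).toRingHom _ η ?_ ?_ ?_ H
  · intro c
    simp [sysDer_C_C, hδ]
  · simp [sysDer_C_X, fieldY, h.der_y, map_ofNat]
  · simp [sysDer_X, fieldX, h.der_x, map_ofNat]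

end

end

section

variable {K : Type*} [Field K] {L : Type*} [Field L] [Algebra K L]

lemma map_evalAt {A B : Type*} [CommRing A] [Algebra K A] [CommRing B] [Algebra K B]
    (f : A →ₐ[K] B) (p q : A) (F : K[X][X]) :
    f (evalAt p q F) = evalAt (f p) (f q) F := by
  induction F using bivariate_induction with
  | hadd F G hF hG => simp [hF, hG]
  | hmul F G hF hG => simp [hF, hG]
  | hC c => simp
  | hy => simp
  | hx => simp

lemma evalAt_C_X_X (F : K[X][X]) : evalAt (C X : K[X][X]) X F = F := by
  induction F using bivariate_induction with
  | hadd F G hF hG => simp [hF, hG]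
  | hmul F G hF hG => simp [hF, hG]
  | hC c => simp
  | hy => simp
  | hx => simp

/-- The degree in the inner variable `y` of an element of `K[y][x]`. -/
def degY (F : K[X][X]) : ℕ := (evalAt (X : K[X][X]) (C X) F).natDegree

lemma coeff_coeff_evalAt_swap (F : K[X][X]) (i j : ℕ) :
    ((evalAt (X : K[X][X]) (C X) F).coeff i).coeff j = (F.coeff j).coeff i := by
  induction F using Polynomial.induction_on' with
  | add p q hp hq => simp [hp, hq]
  | monomial n f =>
    induction f using Polynomial.induction_on' with
    | add p q hp hq => simp only [map_add, coeff_add, hp, hq]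
    | monomial m r =>
      rw [show evalAt (X : K[X][X]) (C X) (monomial n (monomial m r)) =
        monomial m (monomial n r) from Bivariate.swap_monomial_monomial n m r]
      simp only [coeff_monomial]
      split_ifs <;> simp_all [coeff_monomial]

lemma coeff_coeff_eq_zero {F : K[X][X]} {i j : ℕ} (h : degY F < i) : (F.coeff j).coeff i = 0 := by
  rw [← coeff_coeff_evalAt_swap, coeff_eq_zero_of_natDegree_lt h, coeff_zero]

lemma natDegree_coeff_le (F : K[X][X]) (j : ℕ) : (F.coeff j).natDegree ≤ degY F :=
  natDegree_le_iff_coeff_eq_zero.2 fun _ h => coeff_coeff_eq_zero h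

lemma natDegree_evalAt_le (F : K[X][X]) {p q : K[X][X]} {u v : ℕ} (hp : p.natDegree ≤ u)
    (hq : q.natDegree ≤ v) : (evalAt p q F).natDegree ≤ degY F * u + F.natDegree * v := by
  have h1 : ∀ f : K[X], (evalAt p q (C f)).natDegree ≤ f.natDegree * u := by
    intro f
    conv_lhs => rw [f.as_sum_range_C_mul_X_pow]
    simp only [map_sum, map_mul, map_pow, evalAt_C_C, evalAt_C_X]
    refine natDegree_sum_le_of_forall_le _ _ fun i hi => ?_
    rw [Finset.mem_range] at hi
    refine natDegree_mul_le.trans ?_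
    rw [show (algebraMap K K[X][X] (f.coeff i)) = C (C (f.coeff i)) from rfl, natDegree_C, zero_add]
    exact natDegree_pow_le.trans (Nat.mul_le_mul (by lia) hp)
  conv_lhs => rw [F.as_sum_range_C_mul_X_pow]
  simp only [map_sum, map_mul, map_pow, evalAt_X]
  refine natDegree_sum_le_of_forall_le _ _ fun i hi => ?_
  rw [Finset.mem_range] at hi
  refine natDegree_mul_le.trans (add_le_add ((h1 _).trans ?_) ?_)
  · exact Nat.mul_le_mul_right _ (natDegree_coeff_le F i)
  · exact natDegree_pow_le.trans (Nat.mul_le_mul (by lia) hq)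

lemma degY_evalAt_le (F : K[X][X]) {p q : K[X][X]} {u v : ℕ} (hp : degY p ≤ u)
    (hq : degY q ≤ v) : degY (evalAt p q F) ≤ degY F * u + F.natDegree * v := by
  rw [degY, map_evalAt]
  exact natDegree_evalAt_le F hp hq

lemma evalAt_swap_swap (F : K[X][X]) :
    evalAt (X : K[X][X]) (C X) (evalAt (X : K[X][X]) (C X) F) = F :=
  Bivariate.swap_swap_apply F

lemma evalAt_swap_ne_zero {F : K[X][X]} (h : F ≠ 0) : evalAt (X : K[X][X]) (C X) F ≠ 0 := by
  intro h0
  apply h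
  rw [← evalAt_swap_swap F, h0, map_zero]

lemma degY_mul {F G : K[X][X]} (hF : F ≠ 0) (hG : G ≠ 0) : degY (F * G) = degY F + degY G := by
  rw [degY, map_mul, natDegree_mul (evalAt_swap_ne_zero hF) (evalAt_swap_ne_zero hG), degY, degY]

/-- The substitution `y ↦ x / t`, `x ↦ -t y`, which exchanges the variables. -/
def rot (t : K) : K[X][X] →ₐ[K] K[X][X] := evalAt (C (C t⁻¹) * X) (C (C (-t) * X))

/-- The substitution `y ↦ 1 - y`, `x ↦ -x`. -/
def refl : K[X][X] →ₐ[K] K[X][X] := evalAt (1 - C X) (-X)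

lemma natDegree_rot_le (t : K) (F : K[X][X]) : (rot t F).natDegree ≤ degY F := by
  have := natDegree_evalAt_le F (p := C (C t⁻¹) * X) (q := C (C (-t) * X)) (u := 1) (v := 0)
    ((natDegree_C_mul_le _ _).trans natDegree_X_le) (by rw [natDegree_C])
  rw [rot]
  simpa only [mul_one, mul_zero, add_zero, zero_add] using this

lemma degY_rot_le (t : K) (F : K[X][X]) : degY (rot t F) ≤ F.natDegree := by
  have := degY_evalAt_le F (p := C (C t⁻¹) * X) (q := C (C (-t) * X)) (u := 0) (v := 1)
    (by rw [degY, map_mul, evalAt_C_C, evalAt_X,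
          show algebraMap K K[X][X] t⁻¹ = C (C t⁻¹) from rfl, ← C_mul, natDegree_C])
    (by rw [degY, C_mul, map_mul, evalAt_C_C, evalAt_C_X,
          show algebraMap K K[X][X] (-t) = C (C (-t)) from rfl]; exact (natDegree_C_mul_le _ _).trans natDegree_X_le)
  rw [rot]
  simpa only [mul_one, mul_zero, add_zero, zero_add] using this

lemma natDegree_refl_le (F : K[X][X]) : (refl F).natDegree ≤ F.natDegree := by
  have := natDegree_evalAt_le F (p := 1 - C X) (q := -X) (u := 0) (v := 1)
    (by rw [← C_1, ← C_sub, natDegree_C]) (by rw [natDegree_neg, natDegree_X])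
  rw [refl]
  simpa only [mul_one, mul_zero, add_zero, zero_add] using this

lemma degY_refl_le (F : K[X][X]) : degY (refl F) ≤ degY F := by
  have := degY_evalAt_le F (p := 1 - C X) (q := -X) (u := 1) (v := 0)
    (by rw [degY, map_sub, map_one, evalAt_C_X]
        exact (natDegree_sub_le _ _).trans (by simp))
    (by rw [degY, map_neg, evalAt_X, natDegree_neg, natDegree_C])
  rw [refl]
  simpa only [mul_one, mul_zero, add_zero, zero_add] using this

lemma refl_refl (F : K[X][X]) : refl (refl F) = F := by
  have h := map_evalAt (K := K) refl (1 - C X) (-X) F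
  rw [refl] at h ⊢
  rw [h]
  simp [evalAt_C_X_X]

lemma rot_neg_rot {t : K} (ht : t ≠ 0) (F : K[X][X]) : rot (-t) (rot t F) = F := by
  have h := map_evalAt (K := K) (rot (-t)) (C (C t⁻¹) * X) (C (C (-t) * X)) F
  rw [rot] at h ⊢
  rw [rot, h]
  have hC : ∀ c : K, algebraMap K K[X][X] c = C (C c) := fun _ => rfl
  simp only [map_mul, evalAt_C_C, evalAt_X, evalAt_C_X, neg_neg, hC, ← mul_assoc]
  simp only [← C_mul]
  rw [inv_mul_cancel₀ ht, inv_neg, neg_mul_neg, mul_inv_cancel₀ ht]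
  simp [evalAt_C_X_X]

lemma coeff_coeff_rot (t : K) (F : K[X][X]) (i j : ℕ) :
    ((rot t F).coeff i).coeff j = (F.coeff j).coeff i * (t⁻¹) ^ i * (-t) ^ j := by
  induction F using Polynomial.induction_on' with
  | add p q hp hq => simp [hp, hq, add_mul]
  | monomial n f =>
    induction f using Polynomial.induction_on' with
    | add p q hp hq => simp only [map_add, coeff_add, hp, hq, add_mul]
    | monomial m r =>
      have : rot t (monomial n (monomial m r)) =
          monomial m (monomial n (r * (t⁻¹) ^ m * (-t) ^ n)) := by
        rw [rot]
        simp only [← C_mul_X_pow_eq_monomial, map_mul, map_pow, evalAt_C_C,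
          evalAt_C_X, evalAt_X]
        rw [show ∀ c : K, algebraMap K K[X][X] c = C (C c) from fun _ => rfl]
        ring
      rw [this]
      simp only [coeff_monomial]
      split_ifs <;> simp_all [coeff_monomial]

section

variable {δ : Derivation ℤ K K} {η : Derivation ℤ L L} {t a b e : K} {y x : L} {F : K[X][X]}

lemma rot_sysDer (ht : δ t = t) (t_ne : t ≠ 0) (F : K[X][X]) :
    rot t (sysDer δ t a b e F) = sysDer δ (-t) (-(a + 1)) (-e) (-b) (rot t F) := by
  have hinv : δ t⁻¹ = -t⁻¹ := by
    rw [Derivation.leibniz_inv, ht]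
    simp [sq, t_ne]
  have hk : (C (C t) : K[X][X]) * C (C t⁻¹) = 1 := by
    rw [← C_mul, ← C_mul, mul_inv_cancel₀ t_ne]; simp
  refine intertwine (rot t).toRingHom _ _ ?_ ?_ ?_ F
  · intro c
    simp only [AlgHom.toRingHom_eq_coe, RingHom.coe_coe, sysDer_C_C, rot, evalAt_C_C]
    exact (sysDer_C_C ..).symm
  · simp only [AlgHom.toRingHom_eq_coe, RingHom.coe_coe, sysDer_C_X, rot, evalAt_C_X, fieldY,
      map_add, map_sub, map_mul, map_pow, map_ofNat, evalAt_X, evalAt_C_C,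
          Derivation.leibniz, sysDer_C_C, sysDer_X, hinv, fieldX, smul_eq_mul, map_neg, map_one]
    simp only [show ∀ c : K, algebraMap K K[X][X] c = C (C c) from fun _ => rfl]
    generalize (C (C t) : K[X][X]) = T at *
    generalize (C (C t⁻¹) : K[X][X]) = S at *
    grind
  · simp only [AlgHom.toRingHom_eq_coe, RingHom.coe_coe, sysDer_C_X, rot, evalAt_C_X, fieldY,
      map_add, map_sub, map_mul, map_pow, map_ofNat, evalAt_X, evalAt_C_C,
          Derivation.leibniz, sysDer_C_C, sysDer_X, fieldX, smul_eq_mul, map_neg, map_one]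
    simp only [show ∀ c : K, algebraMap K K[X][X] c = C (C c) from fun _ => rfl, ht]
    generalize (C (C t) : K[X][X]) = T at *
    generalize (C (C t⁻¹) : K[X][X]) = S at *
    grind

lemma refl_sysDer (F : K[X][X]) :
    refl (sysDer δ t a b e F) = sysDer δ (-t) a (-a - b) e (refl F) := by
  refine intertwine refl.toRingHom _ _ ?_ ?_ ?_ F
  · intro c
    simp only [AlgHom.toRingHom_eq_coe, RingHom.coe_coe, sysDer_C_C, refl, evalAt_C_C]
    exact (sysDer_C_C ..).symm
  · simp only [AlgHom.toRingHom_eq_coe, RingHom.coe_coe, sysDer_C_X, refl, evalAt_C_X, fieldY,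
      map_add, map_sub, map_mul, map_pow, map_ofNat, evalAt_X, evalAt_C_C, Derivation.map_one_eq_zero,
      map_neg]
    simp only [show ∀ c : K, algebraMap K K[X][X] c = C (C c) from fun _ => rfl]
    ring
  · simp only [AlgHom.toRingHom_eq_coe, RingHom.coe_coe, refl, evalAt_C_X, map_add, map_sub, map_mul, map_pow,
      map_ofNat, evalAt_X, evalAt_C_C, sysDer_X, fieldX, map_neg]
    simp only [show ∀ c : K, algebraMap K K[X][X] c = C (C c) from fun _ => rfl]
    ring

lemma DependentSolution.rot (hδ : ∀ k, η (algebraMap K L k) = algebraMap K L (δ k))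
    (h : DependentSolution δ η t a b e y x F) :
    DependentSolution δ η (-t) (-(a + 1)) (-e) (-b) (algebraMap K L (-t⁻¹) * x)
      (algebraMap K L t * y) (rot t F) := by
  have hinv : δ t⁻¹ = -t⁻¹ := by
    rw [Derivation.leibniz_inv, h.der_t]
    simp [sq, h.t_ne]
  have hk : algebraMap K L t * algebraMap K L t⁻¹ = 1 := by
    rw [← map_mul, mul_inv_cancel₀ h.t_ne, map_one]
  have alg : ∀ {c : K} {z : L}, c ≠ 0 → IsAlgebraic K (algebraMap K L c * z) →
      IsAlgebraic K z := by
    intro c z hc hz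
    have := (isAlgebraic_algebraMap (R := K) (A := L) c⁻¹).mul hz
    rwa [← mul_assoc, ← map_mul, inv_mul_cancel₀ hc, map_one, one_mul] at this
  refine ⟨by simp [h.der_t], neg_ne_zero.2 h.t_ne, by simp [h.der_a], by simp [h.der_e],
    by simp [h.der_b], ?_, ?_, ?_, ?_, ?_⟩
  · simp only [Derivation.leibniz, hδ, map_neg, hinv, h.der_x, smul_eq_mul, map_add, map_one,
      map_mul]
    generalize algebraMap K L t = T at *
    generalize algebraMap K L t⁻¹ = S at *
    grind
  · simp only [Derivation.leibniz, hδ, map_neg, h.der_t, h.der_y, smul_eq_mul, map_add, map_one,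
      map_mul]
    generalize algebraMap K L t = T at *
    generalize algebraMap K L t⁻¹ = S at *
    grind
  · rintro ⟨h1, h2⟩
    exact h.not_algebraic ⟨alg h.t_ne h2, alg (neg_ne_zero.2 (inv_ne_zero h.t_ne)) h1⟩
  · intro h0
    apply h.ne_zero
    rw [← rot_neg_rot h.t_ne F, h0, map_zero]
  · rw [PainleveV.rot, map_evalAt, ← h.eval_eq_zero]
    simp only [map_mul, evalAt_C_C, evalAt_X, evalAt_C_X, ← mul_assoc, map_neg, hk, neg_mul_neg]
    rw [mul_comm (algebraMap K L t⁻¹), hk, one_mul, one_mul]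

lemma DependentSolution.refl (h : DependentSolution δ η t a b e y x F) :
    DependentSolution δ η (-t) a (-a - b) e (1 - y) (-x) (refl F) := by
  refine ⟨by simp [h.der_t], neg_ne_zero.2 h.t_ne, h.der_a, by simp [h.der_a, h.der_b],
    h.der_e, ?_, ?_, ?_, ?_, ?_⟩
  · simp only [map_sub, map_neg, h.der_y, Derivation.map_one_eq_zero]
    ring
  · simp only [map_neg, h.der_x, map_mul]
    ring
  · rintro ⟨h1, h2⟩
    refine h.not_algebraic ⟨?_, by simpa using h2.neg⟩
    simpa using isAlgebraic_one.sub h1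
  · intro h0
    apply h.ne_zero
    rw [← refl_refl F, h0, map_zero]
  · rw [PainleveV.refl, map_evalAt, ← h.eval_eq_zero]
    simp

end

end

section

variable {K : Type*} [Field K] {L : Type*} [Field L] [Algebra K L]

lemma evalAt_C_X_eq_comp (q F : K[X][X]) : evalAt (C X : K[X][X]) q F = F.comp q := by
  induction F using bivariate_induction with
  | hadd F G hF hG => simp [hF, hG]
  | hmul F G hF hG => simp [hF, hG]
  | hC c => simp
  | hy => simp
  | hx => simp

/-- The substitution `z ↦ y x + β` from `K[y][z]` to `K[y][x]`. -/
def chart (β : K) : K[X][X] →ₐ[K] K[X][X] := evalAt (C X) (C X * X + C (C β))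

lemma chart_C_X (β : K) : chart β (C X) = C X := by simp [chart]

lemma chart_X (β : K) : chart β X = C X * X + C (C β) := by simp [chart]

lemma chart_C_C (β c : K) : chart β (C (C c)) = C (C c) := by
  rw [chart, evalAt_C_C]; rfl

lemma chart_injective (β : K) : Function.Injective (chart β) := by
  rw [injective_iff_map_eq_zero]
  intro F h
  rw [chart, evalAt_C_X_eq_comp, comp_eq_zero_iff] at h
  refine h.resolve_right fun h => ?_
  have := congrArg (fun p : K[X][X] => p.coeff 1) h.2
  simp [coeff_C_succ] at this

lemma chart_zero_scaleRoots (F : K[X][X]) :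
    chart 0 (scaleRoots F X) = C X ^ F.natDegree * F := by
  rw [chart, evalAt_C_X_eq_comp, C_0, C_0, add_zero, comp, scaleRoots_eval₂_mul]
  congr 1
  exact comp_X

lemma degY_C (f : K[X]) : degY (C f : K[X][X]) = f.natDegree := by
  have : evalAt (X : K[X][X]) (C X) (C f) = f.map C := by
    induction f using Polynomial.induction_on with
    | C a => simp
    | add f g hf hg => simp [hf, hg]
    | monomial n a h =>
      simp only [map_mul, map_pow, evalAt_C_C, evalAt_C_X, Polynomial.map_mul, Polynomial.map_pow,
        map_C, map_X]
      rfl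
  rw [degY, this, natDegree_map]

lemma degY_mul_le (F G : K[X][X]) : degY (F * G) ≤ degY F + degY G := by
  rw [degY, map_mul]
  exact natDegree_mul_le

lemma degY_pow_le (F : K[X][X]) (n : ℕ) : degY (F ^ n) ≤ n * degY F := by
  rw [degY, map_pow]
  exact natDegree_pow_le

lemma degY_sum_le {ι : Type*} (s : Finset ι) (f : ι → K[X][X]) {n : ℕ}
    (h : ∀ i ∈ s, degY (f i) ≤ n) : degY (∑ i ∈ s, f i) ≤ n := by
  rw [degY, map_sum]
  exact natDegree_sum_le_of_forall_le _ _ h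

lemma degY_chart_scaleRoots_le (β : K) (F : K[X][X]) :
    degY (chart β (scaleRoots F X)) ≤ degY F + F.natDegree := by
  have h1 : degY (C X * X + C (C β) : K[X][X]) ≤ 1 := by
    rw [degY, map_add, map_mul, evalAt_C_X, evalAt_X, evalAt_C_C]
    refine (natDegree_add_le _ _).trans (max_le ?_ ?_)
    · rw [mul_comm]
      exact (natDegree_C_mul_le _ _).trans natDegree_X_le
    · exact (natDegree_C (C β)).le.trans zero_le_one
  rw [chart, evalAt_C_X_eq_comp, comp, eval₂_eq_sum_range]
  refine degY_sum_le _ _ fun i hi => ?_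
  rw [natDegree_scaleRoots, Finset.mem_range] at hi
  rw [coeff_scaleRoots, C_mul]
  refine (degY_mul_le _ _).trans ?_
  have h2 := degY_mul_le (C (F.coeff i)) (C (X ^ (F.natDegree - i)) : K[X][X])
  rw [degY_C, degY_C, natDegree_X_pow] at h2
  have h3 := natDegree_coeff_le F i
  have h4 := (degY_pow_le (C X * X + C (C β) : K[X][X]) i).trans (Nat.mul_le_mul_left i h1)
  lia

lemma natDegree_chart_le (β : K) (F : K[X][X]) : (chart β F).natDegree ≤ F.natDegree := by
  have := natDegree_evalAt_le F (p := C X) (q := C X * X + C (C β)) (u := 0) (v := 1)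
    (natDegree_C _).le
    ((natDegree_add_le _ _).trans (max_le ((natDegree_C_mul_le _ _).trans natDegree_X_le)
      ((natDegree_C _).le.trans zero_le_one)))
  rw [chart]
  simpa only [mul_zero, mul_one, zero_add] using this

/-- The derivation of `K[y][z]` induced by the system with `z = y x`, multiplied by `y t`. -/
def chartDer (δ : Derivation ℤ K K) (t a b e : K) : Derivation ℤ K[X][X] K[X][X] :=
  vectorField δ (C X)
    (C X * (2 * C X * X - 2 * X + C (C t) * C X ^ 2 - C (C t) * C X + C (C a) * C X + C (C b)))
    (X * (C (C b) - X) + C (C t) * C X ^ 2 * (C (C e) - X))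

lemma chart_zero_chartDer (δ : Derivation ℤ K K) (t a b e : K) (F : K[X][X]) :
    chart 0 (chartDer δ t a b e F) = C X * sysDer δ t a b e (chart 0 F) := by
  refine intertwine (chart 0).toRingHom _ ((C X : K[X][X]) • sysDer δ t a b e) ?_ ?_ ?_ F
  · intro c
    simp [chartDer, vectorField_C_C, sysDer_C_C, chart_C_X, chart_C_C]
  · simp only [AlgHom.toRingHom_eq_coe, RingHom.coe_coe, chartDer, vectorField_C_X, chart_C_X,
      chart_X, chart_C_C, map_mul, map_add, map_sub, map_pow, map_ofNat, Derivation.smul_apply,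
      smul_eq_mul, sysDer_C_X, fieldY, C_0, add_zero]
    ring
  · simp only [AlgHom.toRingHom_eq_coe, RingHom.coe_coe, chartDer, vectorField_X, chart_C_X,
      chart_X, chart_C_C, map_mul, map_add, map_sub, map_pow, Derivation.smul_apply,
      smul_eq_mul, sysDer_C_X, sysDer_X, Derivation.leibniz, fieldY, fieldX, C_0, add_zero]
    ring

lemma chart_chartDer {δ : Derivation ℤ K K} {b : K} (hb : δ b = 0) (t a e : K) (F : K[X][X]) :
    chart b (chartDer δ t a b e F) =
      C X * sysDer δ t (a + 2 * b) (-b) (e - b) (chart b F) := by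
  have h2 : (C (C (2 : K)) : K[X][X]) = 2 := rfl
  refine intertwine (chart b).toRingHom _
    ((C X : K[X][X]) • sysDer δ t (a + 2 * b) (-b) (e - b)) ?_ ?_ ?_ F
  · intro c
    simp [chartDer, vectorField_C_C, sysDer_C_C, chart_C_X, chart_C_C]
  · simp only [AlgHom.toRingHom_eq_coe, RingHom.coe_coe, chartDer, vectorField_C_X, chart_C_X,
      chart_X, chart_C_C, map_mul, map_add, map_sub, map_neg, map_pow, map_ofNat,
      Derivation.smul_apply, smul_eq_mul, sysDer_C_X, fieldY]
    ring
  · simp only [AlgHom.toRingHom_eq_coe, RingHom.coe_coe, chartDer, vectorField_X, chart_C_X,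
      chart_X, chart_C_C, map_mul, map_add, map_sub, map_neg, map_pow, map_ofNat,
      Derivation.smul_apply, smul_eq_mul, sysDer_C_X, sysDer_X, sysDer_C_C, hb,
      Derivation.leibniz, fieldY, fieldX, C_0]
    ring

lemma derivation_pow_mul {A : Type*} [CommRing A] [Algebra ℤ A] (D : Derivation ℤ A A) (p : A)
    (n : ℕ) : p * D (p ^ n) = n * p ^ n * D p := by
  induction n with
  | zero => simp
  | succ n ih =>
    rw [pow_succ, Derivation.leibniz, smul_eq_mul, smul_eq_mul, mul_add, mul_left_comm, ih]
    push_cast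
    ring

/-- The bilinear polynomial `α x y + β y + γ x + ε`. -/
def bilin (α β γ ε : K) : K[X][X] :=
  C (C α) * (C X * X) + C (C β) * C X + C (C γ) * X + C (C ε)

variable {δ : Derivation ℤ K K} {η : Derivation ℤ L L} {t a b e : K} {y x : L} {F : K[X][X]}

lemma chartDer_scaleRoots {g₁₁ g₁₀ g₀₁ g₀₀ : K}
    (hF : sysDer δ t a b e F = bilin g₁₁ g₁₀ g₀₁ g₀₀ * F) :
    chartDer δ t a b e (scaleRoots F X) =
      ((F.natDegree : K[X][X]) * (2 * C X * X - 2 * X + C (C t) * C X ^ 2 - C (C t) * C X + C (C a) * C X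
        + C (C b)) + C (C g₁₁) * (C X * X) + C (C g₁₀) * C X ^ 2 + C (C g₀₁) * X
        + C (C g₀₀) * C X) * scaleRoots F X := by
  apply chart_injective 0
  rw [chart_zero_chartDer, chart_zero_scaleRoots, Derivation.leibniz, hF, map_mul,
    chart_zero_scaleRoots, smul_eq_mul, smul_eq_mul, mul_add, mul_left_comm (C X) F,
    derivation_pow_mul, sysDer_C_X]
  simp only [bilin, fieldY, map_add, map_sub, map_mul, map_pow, map_natCast, map_ofNat, chart_C_X,
    chart_C_C, chart_X, C_0, add_zero]
  ring

lemma sysDer_of_pow_mul_eq_chart {g₁₁ g₁₀ g₀₁ g₀₀ : K} (hb : δ b = 0) (hb0 : b ≠ 0)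
    (hF : sysDer δ t a b e F = bilin g₁₁ g₁₀ g₀₁ g₀₀ * F) {G : K[X][X]} {l : ℕ}
    (hG : chart b (scaleRoots F X) = C X ^ l * G) (hdvd : ¬ (C X : K[X][X]) ∣ G) :
    (l : K) = F.natDegree - g₀₁ := by
  have hX : (C X : K[X][X]) ≠ 0 := by simp
  have hprime : Prime (C X : K[X][X]) := prime_C_iff.2 prime_X
  have h := chart_chartDer hb t a e (scaleRoots F X)
  rw [chartDer_scaleRoots hF, map_mul, hG, Derivation.leibniz, smul_eq_mul, smul_eq_mul, mul_add (C X),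
    mul_left_comm (C X) G, derivation_pow_mul, sysDer_C_X] at h
  simp only [map_add, map_sub, map_mul, map_pow, map_natCast, map_ofNat, chart_C_X,
    chart_C_C, chart_X] at h
  have h2 : (C X : K[X][X]) ∣ G * (((F.natDegree : K[X][X]) * (2 * C X * (C X * X + C (C b))
      - 2 * (C X * X + C (C b)) + C (C t) * C X ^ 2 - C (C t) * C X + C (C a) * C X + C (C b))
      + C (C g₁₁) * (C X * (C X * X + C (C b))) + C (C g₁₀) * C X ^ 2
      + C (C g₀₁) * (C X * X + C (C b)) + C (C g₀₀) * C X)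
      - (l : K[X][X]) * fieldY t (a + 2 * b) (-b)) := by
    refine ⟨sysDer δ t (a + 2 * b) (-b) (e - b) G, mul_left_cancel₀ (pow_ne_zero l hX) ?_⟩
    linear_combination h
  obtain ⟨M, hM⟩ := (hprime.dvd_or_dvd h2).resolve_left hdvd
  have h3 := congrArg (evalAt (0 : K) (0 : K)) hM
  simp [fieldY, map_ofNat] at h3
  have h4 : b * (l - (F.natDegree - g₀₁)) = 0 := by linear_combination h3
  exact sub_eq_zero.1 ((mul_eq_zero.1 h4).resolve_left hb0)

lemma DependentSolution.y_ne_zero (h : DependentSolution δ η t a b e y x F) (hb : b ≠ 0) :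
    y ≠ 0 := by
  intro hy
  have := h.der_y
  simp [hy] at this
  exact hb ((map_eq_zero _).1 this.symm)

lemma DependentSolution.reflect (hδ : ∀ k, η (algebraMap K L k) = algebraMap K L (δ k))
    (h : DependentSolution δ η t a b e y x F) (hb : b ≠ 0) :
    ∃ (G : K[X][X]) (l : ℕ),
      DependentSolution δ η t (a + 2 * b) (-b) (e - b) y (x - algebraMap K L b / y) G ∧
      G.natDegree ≤ F.natDegree ∧ degY G + l ≤ degY F + F.natDegree ∧
      ∀ g₁₁ g₁₀ g₀₁ g₀₀, sysDer δ t a b e F = bilin g₁₁ g₁₀ g₀₁ g₀₀ * F →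
        (l : K) = F.natDegree - g₀₁ := by
  have hy := h.y_ne_zero hb
  have hX : (C X : K[X][X]) ≠ 0 := by simp
  have hprime : Prime (C X : K[X][X]) := prime_C_iff.2 prime_X
  have hH : chart b (scaleRoots F X) ≠ 0 :=
    (map_ne_zero_iff _ (chart_injective b)).2 (scaleRoots_ne_zero h.ne_zero _)
  obtain ⟨G, hG, hdvd⟩ :=
    (FiniteMultiplicity.of_prime_left hprime hH).exists_eq_pow_mul_and_not_dvd
  have hG0 : G ≠ 0 := by
    rintro rfl
    exact hdvd (dvd_zero _)
  have hyx : y * (x - algebraMap K L b / y) + algebraMap K L b = y * x := by field_simp; ring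
  refine ⟨G, multiplicity (C X) (chart b (scaleRoots F X)), ⟨h.der_t, h.t_ne, ?_, ?_, ?_, ?_, ?_,
    ?_, hG0, ?_⟩, ?_, ?_, fun _ _ _ _ hF => sysDer_of_pow_mul_eq_chart h.der_b hb hF hG hdvd⟩
  · simp [h.der_a, h.der_b, two_mul]
  · simp [h.der_b]
  · simp [h.der_b, h.der_e]
  · rw [h.der_y]
    simp only [map_add, map_mul, map_neg, map_ofNat]
    field_simp
    ring
  · have hinv : η (algebraMap K L b / y) = -(algebraMap K L b / y ^ 2 * η y) := by
      rw [Derivation.leibniz_div, hδ, h.der_b]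
      simp
      ring
    rw [map_sub, hinv, h.der_y, h.der_x]
    simp only [map_add, map_sub, map_mul, map_ofNat]
    field_simp
    ring
  · rintro ⟨h1, h2⟩
    refine h.not_algebraic ⟨h1, ?_⟩
    simpa [div_eq_mul_inv] using h2.add ((isAlgebraic_algebraMap (R := K) b).mul h1.inv)
  · have h1 : evalAt y (x - algebraMap K L b / y) (chart b (scaleRoots F X)) = 0 := by
      have h2 := map_evalAt (evalAt (K := K) y x) (C X) (C X * X + C (C 0)) (scaleRoots F X)
      have h3 := chart_zero_scaleRoots F
      rw [chart] at h3 ⊢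
      rw [h3, map_mul, h.eval_eq_zero, mul_zero] at h2
      rw [map_evalAt, h2]
      simp [hyx]
    rw [hG, map_mul, map_pow, evalAt_C_X] at h1
    exact (mul_eq_zero.1 h1).resolve_left (pow_ne_zero _ hy)
  · have := natDegree_chart_le b (scaleRoots F X)
    rw [natDegree_scaleRoots] at this
    conv_lhs at this => rw [hG, natDegree_mul (pow_ne_zero _ hX) hG0, ← C_pow, natDegree_C, zero_add]
    exact this
  · have := degY_chart_scaleRoots_le b F
    conv_lhs at this => rw [hG, degY_mul (pow_ne_zero _ hX) hG0, ← C_pow, degY_C, natDegree_X_pow]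
    rwa [add_comm]

end

section

variable {K : Type*} [Field K] {L : Type*} [Field L] [Algebra K L]

lemma evalAt_eq_eval₂ (y x : L) (F : K[X][X]) :
    evalAt y x F = eval₂ (aeval (R := K) y).toRingHom x F := by
  induction F using bivariate_induction with
  | hadd F G hF hG => simp [hF, hG]
  | hmul F G hF hG => rw [map_mul, eval₂_mul, hF, hG]
  | hC c => simp
  | hy => simp
  | hx => simp

lemma isAlgebraic_of_not_dvd {y x : L} {F H : K[X][X]} (hF : Irreducible F) (hdvd : ¬ F ∣ H)
    (hF0 : evalAt y x F = 0) (hH0 : evalAt y x H = 0) : IsAlgebraic K y := by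
  by_contra hy
  have hinj : Function.Injective (aeval (R := K) y).toRingHom :=
    (injective_iff_map_eq_zero _).2 fun p hp => by
      by_contra h
      exact hy ⟨p, h, hp⟩
  have hdeg : F.natDegree ≠ 0 := by
    intro h
    rw [eq_C_of_natDegree_eq_zero h, evalAt_eq_eval₂, eval₂_C] at hF0
    have h0 := (map_eq_zero_iff _ hinj).1 hF0
    apply hF.ne_zero
    rw [eq_C_of_natDegree_eq_zero h, h0, C_0]
  have hprim := hF.isPrimitive hdeg
  let Q := FractionRing K[X]
  have hF' : Irreducible (F.map (algebraMap K[X] Q)) :=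
    hprim.irreducible_iff_irreducible_map_fraction_map.1 hF
  have hdvd' : ¬ F.map (algebraMap K[X] Q) ∣ H.map (algebraMap K[X] Q) := fun h =>
    hdvd (hprim.dvd_of_fraction_map_dvd_fraction_map h)
  obtain ⟨u, v, huv⟩ := (hF'.coprime_iff_not_dvd).2 hdvd'
  have h := congrArg (eval₂ (IsFractionRing.lift hinj : Q →+* L) x) huv
  have hlift : ∀ G : K[X][X], eval₂ (IsFractionRing.lift hinj : Q →+* L) x
      (G.map (algebraMap K[X] Q)) = evalAt y x G := by
    intro G
    rw [eval₂_map, evalAt_eq_eval₂]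
    congr 1
    refine RingHom.ext fun p => ?_
    exact IsFractionRing.lift_algebraMap hinj p
  rw [eval₂_add, eval₂_mul, eval₂_mul, hlift, hlift, hF0, hH0] at h
  simp at h

lemma evalAt_swap (y x : L) (F : K[X][X]) :
    evalAt x y (evalAt (X : K[X][X]) (C X) F) = evalAt y x F := by
  rw [map_evalAt, evalAt_X, evalAt_C_X]

lemma isUnit_of_natDegree_eq_zero {F : K[X][X]} (hF : F ≠ 0) (hx : F.natDegree = 0)
    (hy : degY F = 0) : IsUnit F := by
  obtain ⟨f, rfl⟩ := natDegree_eq_zero.1 hx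
  rw [degY_C] at hy
  obtain ⟨c, rfl⟩ := natDegree_eq_zero.1 hy
  rw [isUnit_C, isUnit_C, isUnit_iff_ne_zero]
  rintro rfl
  simp at hF

lemma dvd_of_minimal {y x : L} (hyx : ¬ (IsAlgebraic K y ∧ IsAlgebraic K x)) {F : K[X][X]}
    (hF : F ≠ 0) (hF0 : evalAt y x F = 0)
    (hmin : ∀ G : K[X][X], G ≠ 0 → evalAt y x G = 0 →
      F.natDegree + degY F ≤ G.natDegree + degY G)
    {H : K[X][X]} (hH : evalAt y x H = 0) : F ∣ H := by
  have hirr : Irreducible F := by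
    refine ⟨fun h => ?_, fun A B hAB => ?_⟩
    · exact (h.map (evalAt y x)).ne_zero hF0
    · have hA : A ≠ 0 := by rintro rfl; simp at hAB; exact hF hAB
      have hB : B ≠ 0 := by rintro rfl; simp at hAB; exact hF hAB
      have h1 : F.natDegree = A.natDegree + B.natDegree := by rw [hAB, natDegree_mul hA hB]
      have h2 : degY F = degY A + degY B := by rw [hAB, degY_mul hA hB]
      rw [hAB, map_mul, mul_eq_zero] at hF0
      rcases hF0 with h | h
      · have := hmin A hA h
        exact Or.inr (isUnit_of_natDegree_eq_zero hB (by lia) (by lia))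
      · have := hmin B hB h
        exact Or.inl (isUnit_of_natDegree_eq_zero hA (by lia) (by lia))
  by_contra hdvd
  refine hyx ⟨isAlgebraic_of_not_dvd hirr hdvd hF0 hH, ?_⟩
  let σ : K[X][X] ≃+* K[X][X] := RingEquiv.ofRingHom
    (evalAt (X : K[X][X]) (C X) : K[X][X] →ₐ[K] K[X][X]).toRingHom
    (evalAt (X : K[X][X]) (C X) : K[X][X] →ₐ[K] K[X][X]).toRingHom
    (RingHom.ext evalAt_swap_swap) (RingHom.ext evalAt_swap_swap)
  refine isAlgebraic_of_not_dvd (y := x) (x := y) (F := σ F) (H := σ H)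
    ((MulEquiv.irreducible_iff σ).2 hirr) (fun h => hdvd ((map_dvd_iff σ).1 h)) ?_ ?_
  · exact (evalAt_swap y x F).trans hF0
  · exact (evalAt_swap y x H).trans hH

lemma natDegree_coeffDer_le {R : Type*} [CommRing R] (d : Derivation ℤ R R) (F : R[X]) :
    (coeffDer d F).natDegree ≤ F.natDegree := by
  refine natDegree_le_iff_coeff_eq_zero.2 fun i hi => ?_
  rw [coeff_coeffDer, coeff_eq_zero_of_natDegree_lt hi, map_zero]

lemma natDegree_sysDer_le (δ : Derivation ℤ K K) (t a b e : K) (F : K[X][X]) :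
    (sysDer δ t a b e F).natDegree ≤ F.natDegree + 1 := by
  have h0 := natDegree_coeffDer_le (coeffDer δ) F
  have h1 := natDegree_coeffDer_le (polyDer K) F
  have hY : (fieldY t a b).natDegree ≤ 1 := by
    rw [fieldY]
    compute_degree
  have hX : (fieldX t a e).natDegree ≤ 2 := by
    rw [fieldX]
    compute_degree
  change (1 * coeffDer (coeffDer δ) F + fieldY t a b * coeffDer (polyDer K) F
    + fieldX t a e * derivative F).natDegree ≤ _
  refine (natDegree_add_le _ _).trans (max_le ((natDegree_add_le _ _).trans (max_le ?_ ?_)) ?_)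
  · rw [one_mul]
    exact h0.trans (Nat.le_succ _)
  · exact natDegree_mul_le.trans ((add_le_add hY h1).trans (add_comm _ _).le)
  · rcases Nat.eq_zero_or_pos F.natDegree with h | h
    · rw [derivative_of_natDegree_zero h]
      simp
    · have := natDegree_derivative_lt h.ne'
      exact natDegree_mul_le.trans (by lia)

lemma natDegree_le_one_of_sysDer_eq {δ : Derivation ℤ K K} {t a b e : K} {F G : K[X][X]}
    (hF : F ≠ 0) (h : sysDer δ t a b e F = G * F) : G.natDegree ≤ 1 := by
  by_cases hG : G = 0
  · simp [hG]
  · have := natDegree_sysDer_le δ t a b e F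
    rw [h, natDegree_mul hG hF] at this
    lia

lemma degY_eq_natDegree_rot {t : K} (ht : t ≠ 0) (F : K[X][X]) :
    (rot t F).natDegree = degY F :=
  (natDegree_rot_le t F).antisymm (by
    conv_lhs => rw [← rot_neg_rot ht F]
    exact degY_rot_le _ _)

lemma natDegree_eq_degY_rot {t : K} (ht : t ≠ 0) (F : K[X][X]) :
    degY (rot t F) = F.natDegree :=
  (degY_rot_le t F).antisymm (by
    conv_lhs => rw [← rot_neg_rot ht F]
    exact natDegree_rot_le _ _)

lemma rot_ne_zero {t : K} (ht : t ≠ 0) {F : K[X][X]} (hF : F ≠ 0) : rot t F ≠ 0 := by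
  intro h
  apply hF
  rw [← rot_neg_rot ht F, h, map_zero]

lemma eq_bilin {G : K[X][X]} (hx : G.natDegree ≤ 1) (hy : degY G ≤ 1) :
    ∃ α β γ ε : K, G = bilin α β γ ε := by
  obtain ⟨p, q, hpq⟩ := exists_eq_X_add_C_of_natDegree_le_one hx
  have h1 := natDegree_coeff_le G 1
  have h0 := natDegree_coeff_le G 0
  obtain ⟨α, γ, hp⟩ := exists_eq_X_add_C_of_natDegree_le_one (h1.trans hy)
  obtain ⟨β, ε, hq⟩ := exists_eq_X_add_C_of_natDegree_le_one (h0.trans hy)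
  have hp' : G.coeff 1 = p := by rw [hpq]; simp
  have hq' : G.coeff 0 = q := by rw [hpq]; simp
  refine ⟨α, β, γ, ε, ?_⟩
  rw [hpq, ← hp', ← hq', hp, hq, bilin]
  simp only [C_add, C_mul]
  ring

lemma exists_bilin {δ : Derivation ℤ K K} {t a b e : K} (ht : δ t = t) (ht0 : t ≠ 0)
    {F G : K[X][X]} (hF : F ≠ 0) (h : sysDer δ t a b e F = G * F) :
    ∃ α β γ ε : K, G = bilin α β γ ε := by
  refine eq_bilin (natDegree_le_one_of_sysDer_eq hF h) ?_
  rw [← degY_eq_natDegree_rot ht0]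
  have h' := rot_sysDer (a := a) (b := b) (e := e) ht ht0 F
  rw [h, map_mul] at h'
  exact natDegree_le_one_of_sysDer_eq (rot_ne_zero ht0 hF) h'.symm

lemma refl_bilin (α β γ ε : K) :
    refl (bilin α β γ ε) = bilin α (-β) (-α - γ) (β + ε) := by
  simp only [refl, bilin, map_add, map_mul, map_neg, map_sub, evalAt_C_C, evalAt_C_X, evalAt_X]
  simp only [show ∀ c : K, algebraMap K K[X][X] c = C (C c) from fun _ => rfl]
  ring

lemma rot_bilin {t : K} (ht : t ≠ 0) (α β γ ε : K) :
    rot t (bilin α β γ ε) = bilin (-α) (-(γ * t)) (β * t⁻¹) ε := by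
  have hk : (C (C t) : K[X][X]) * C (C t⁻¹) = 1 := by
    rw [← C_mul, ← C_mul, mul_inv_cancel₀ ht]; simp
  simp only [rot, bilin, map_add, map_mul, map_neg, evalAt_C_C, evalAt_C_X, evalAt_X]
  simp only [show ∀ c : K, algebraMap K K[X][X] c = C (C c) from fun _ => rfl]
  linear_combination (-C (C α) * X * C X) * hk

/-- None of the differences of the underlying parameters is an integer. -/
def Nonint (a b e : K) : Prop :=
  ∀ n : ℤ, b ≠ n ∧ e ≠ n ∧ a + b + e ≠ n ∧ e - b ≠ n ∧ a + e ≠ n ∧ a + b ≠ n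

variable {δ : Derivation ℤ K K} {η : Derivation ℤ L L} {t a b e : K} {y x : L} {F : K[X][X]}

lemma Nonint.rot (h : Nonint a b e) : Nonint (-(a + 1)) (-e) (-b) := by
  intro n
  obtain ⟨h1, h2, -, -, -, -⟩ := h (-n)
  obtain ⟨-, -, h3, -, h5, h6⟩ := h (-n - 1)
  obtain ⟨-, -, -, h4, -, -⟩ := h n
  push_cast at *
  refine ⟨fun h => h2 ?_, fun h => h1 ?_, fun h => h3 ?_, fun h => h4 ?_, fun h => h6 ?_,
    fun h => h5 ?_⟩
  all_goals first | linear_combination (-1 : K) * h | linear_combination h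

lemma Nonint.refl (h : Nonint a b e) : Nonint a (-a - b) e := by
  intro n
  obtain ⟨h1, -, -, -, -, h6⟩ := h (-n)
  obtain ⟨-, h2, h3, h4, h5, -⟩ := h n
  push_cast at *
  refine ⟨fun h => h6 ?_, fun h => h2 ?_, fun h => h4 ?_, fun h => h3 ?_, fun h => h5 ?_,
    fun h => h1 ?_⟩
  all_goals first | linear_combination (-1 : K) * h | linear_combination h

lemma Nonint.reflect (h : Nonint a b e) : Nonint (a + 2 * b) (-b) (e - b) := by
  intro n
  obtain ⟨h1, -, -, -, -, -⟩ := h (-n)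
  obtain ⟨-, h2, h3, h4, h5, h6⟩ := h n
  push_cast at *
  refine ⟨fun h => h1 ?_, fun h => h4 ?_, fun h => h5 ?_, fun h => h2 ?_, fun h => h3 ?_,
    fun h => h6 ?_⟩
  all_goals first | linear_combination (-1 : K) * h | linear_combination h

end

section

variable {K : Type*} [Field K] {L : Type*} [Field L] [Algebra K L]
variable {δ : Derivation ℤ K K} {η : Derivation ℤ L L} {t a b e : K} {y x : L} {F : K[X][X]}

/-- `N` bounds from below the total degree of every relation satisfied by a dependent solution
with non-integral parameters. -/
def IsLowerBound (δ : Derivation ℤ K K) (η : Derivation ℤ L L) (N : ℕ) : Prop :=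
  ∀ ⦃t a b e : K⦄ ⦃y x : L⦄ ⦃F : K[X][X]⦄, DependentSolution δ η t a b e y x F →
    Nonint a b e → N ≤ F.natDegree + degY F

lemma exists_natCast_of_minimal (hδ : ∀ k, η (algebraMap K L k) = algebraMap K L (δ k)) {N : ℕ}
    (hN : IsLowerBound δ η N) (h : DependentSolution δ η t a b e y x F) (hp : Nonint a b e)
    (hF : F.natDegree + degY F ≤ N) {α β γ ε : K}
    (hder : sysDer δ t a b e F = bilin α β γ ε * F) : ∃ k : ℕ, γ = k := by
  have hb : b ≠ 0 := by simpa using (hp 0).1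
  obtain ⟨G, l, hG, hdeg, hdegY, hl⟩ := h.reflect hδ hb
  have := hN hG hp.reflect
  have hln : l ≤ F.natDegree := by lia
  refine ⟨F.natDegree - l, ?_⟩
  rw [Nat.cast_sub hln, hl _ _ _ _ hder]
  ring

lemma exists_sysDer_eq_const_mul [CharZero K]
    (hδ : ∀ k, η (algebraMap K L k) = algebraMap K L (δ k)) {N : ℕ}
    (hN : IsLowerBound δ η N) (h : DependentSolution δ η t a b e y x F) (hp : Nonint a b e)
    (hF : F.natDegree + degY F ≤ N) : ∃ g, sysDer δ t a b e F = C (C g) * F := by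
  have ht := h.t_ne
  obtain ⟨G, hG⟩ : F ∣ sysDer δ t a b e F := by
    refine dvd_of_minimal h.not_algebraic h.ne_zero h.eval_eq_zero (fun G hG hG0 => ?_) ?_
    · exact hF.trans (hN { h with ne_zero := hG, eval_eq_zero := hG0 } hp)
    · rw [h.evalAt_sysDer hδ, h.eval_eq_zero, map_zero]
  rw [mul_comm] at hG
  obtain ⟨α, β, γ, ε, rfl⟩ := exists_bilin h.der_t ht h.ne_zero hG
  have hrefl {t a b e y x F} (h : DependentSolution δ η t a b e y x F)
      (hF : F.natDegree + degY F ≤ N) {α β γ ε : K}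
      (hder : sysDer δ t a b e F = bilin α β γ ε * F) (hp : Nonint a b e) :
      ∃ k : ℕ, -α - γ = k := by
    refine exists_natCast_of_minimal (α := α) (β := -β) (ε := β + ε) hδ hN h.refl hp.refl
      ((add_le_add (natDegree_refl_le F) (degY_refl_le F)).trans hF) ?_
    rw [← refl_sysDer, hder, map_mul, refl_bilin]
  have hF' : (rot t F).natDegree + degY (rot t F) ≤ N := by
    rwa [degY_eq_natDegree_rot ht, natDegree_eq_degY_rot ht, add_comm]
  have hG' : sysDer δ (-t) (-(a + 1)) (-e) (-b) (rot t F) =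
      bilin (-α) (-(γ * t)) (β * t⁻¹) ε * rot t F := by
    rw [← rot_sysDer h.der_t ht, hG, map_mul, rot_bilin ht]
  obtain ⟨k₁, h₁⟩ := exists_natCast_of_minimal hδ hN h hp hF hG
  obtain ⟨k₂, h₂⟩ := hrefl h hF hG hp
  obtain ⟨k₃, h₃⟩ := exists_natCast_of_minimal hδ hN (h.rot hδ) hp.rot hF' hG'
  obtain ⟨k₄, h₄⟩ := hrefl (h.rot hδ) hF' hG' hp.rot
  have hsum : ((k₁ + k₂ + k₃ + k₄ : ℕ) : K) = 0 := by
    push_cast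
    rw [← h₁, ← h₂, ← h₃, ← h₄]
    ring
  rw [Nat.cast_eq_zero] at hsum
  obtain rfl : k₁ = 0 := by lia
  obtain rfl : k₂ = 0 := by lia
  obtain rfl : k₃ = 0 := by lia
  rw [Nat.cast_zero] at h₁ h₂ h₃
  have hβ : β = 0 := (mul_eq_zero.1 h₃).resolve_right (inv_ne_zero ht)
  have hα : α = 0 := by simpa [h₁] using h₂
  refine ⟨ε, ?_⟩
  rw [hG, hα, hβ, h₁]
  simp [bilin]

/-- The invariant quadratic `y² - y`. -/
def quad (K : Type*) [Field K] : K[X] := X ^ 2 - X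

lemma coeff_sysDer_succ (δ : Derivation ℤ K K) (t a b e : K) (F : K[X][X]) (k : ℕ) :
    (sysDer δ t a b e F).coeff (k + 1) =
      coeffDer δ (F.coeff (k + 1))
        + (C t * quad K + C a * X + C b) * derivative (F.coeff (k + 1))
        + 2 * quad K * derivative (F.coeff k)
        + C (e * t) * (((k : K[X]) + 2) * F.coeff (k + 2))
        - (C t * (2 * X - 1) + C a) * (((k : K[X]) + 1) * F.coeff (k + 1))
        - (2 * X - 1) * ((k : K[X]) * F.coeff k) := by
  have hY : fieldY t a b = C (2 * quad K) * X + C (C t * quad K + C a * X + C b) := by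
    simp only [fieldY, quad, C_add, C_mul, C_sub, C_pow]
    rw [show (C 2 : K[X][X]) = 2 from rfl]
    ring
  have hX : fieldX t a e = C (C (e * t)) - C (C t * (2 * X - 1) + C a) * X
      - C (2 * X - 1) * X ^ 2 := by
    simp only [fieldX, C_add, C_mul, C_sub, C_1]
    rw [show (C 2 : K[X][X]) = 2 from rfl]
    ring
  have hd : ∀ (d : Derivation ℤ K[X] K[X]) j, (coeffDer d F).coeff j = d (F.coeff j) :=
    fun d j => coeff_coeffDer d F j
  change (1 * coeffDer (coeffDer δ) F + fieldY t a b * coeffDer (polyDer K) F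
    + fieldX t a e * derivative F).coeff (k + 1) = _
  have hXd : ∀ j, (X * derivative F).coeff j = j * F.coeff j := by
    rintro (_ | j)
    · simp
    · rw [coeff_X_mul, coeff_derivative]
      push_cast
      ring
  have e1 : (fieldY t a b * coeffDer (polyDer K) F) =
      X * (C (2 * quad K) * coeffDer (polyDer K) F)
        + C (C t * quad K + C a * X + C b) * coeffDer (polyDer K) F := by
    rw [hY]
    ring
  have e2 : fieldX t a e * derivative F = C (C (e * t)) * derivative F
      - C (C t * (2 * X - 1) + C a) * (X * derivative F)
      - X * (C (2 * X - 1) * (X * derivative F)) := by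
    rw [hX]
    ring
  rw [e1, e2, one_mul]
  simp only [coeff_add, coeff_sub, coeff_C_mul, coeff_X_mul, hXd, hd, coeff_derivative,
    polyDer_apply]
  push_cast
  ring

end

section

variable {K : Type*} [Field K]

lemma derivative_quad : derivative (quad K) = 2 * X - 1 := by
  simp [quad, one_add_one_eq_two]
  rfl

lemma quad_monic : (quad K).Monic := by
  rw [quad]
  monicity!

lemma natDegree_quad : (quad K).natDegree = 2 := by
  rw [quad]
  compute_degree!

lemma coeff_quad_ode (m k : ℕ) (p : K[X]) :
    (2 * quad K * derivative p - (m : K[X]) * ((2 * X - 1) * p)).coeff (k + 1) =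
      2 * (k - m) * p.coeff k - (2 * k + 2 - m) * p.coeff (k + 1) := by
  have hXd : ∀ j, (X * derivative p).coeff j = j * p.coeff j := by
    rintro (_ | j)
    · simp
    · rw [coeff_X_mul, coeff_derivative]
      push_cast
      ring
  have : 2 * quad K * derivative p - (m : K[X]) * ((2 * X - 1) * p) =
      X * (C 2 * (X * derivative p)) - C 2 * (X * derivative p) - X * (C (2 * (m : K)) * p)
        + C (m : K) * p := by
    rw [quad]
    simp only [C_mul, map_natCast, show (C 2 : K[X]) = 2 from rfl]
    ring
  rw [this]
  simp only [coeff_add, coeff_sub, coeff_C_mul, coeff_X_mul, hXd]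
  push_cast
  ring

lemma quad_ode_pow (q : ℕ) :
    2 * quad K * derivative (quad K ^ q) = ((2 * q : ℕ) : K[X]) * ((2 * X - 1) * quad K ^ q) := by
  rcases q with _ | q
  · simp
  · rw [derivative_pow_succ, derivative_quad]
    push_cast
    simp only [map_add, map_natCast, C_1]
    ring

section ode

variable [CharZero K] {m : ℕ} {p : K[X]}

lemma natDegree_of_quad_ode (h : 2 * quad K * derivative p = (m : K[X]) * ((2 * X - 1) * p))
    (hp : p ≠ 0) :
    p.natDegree = m := by
  have h1 := coeff_quad_ode m p.natDegree p
  rw [h, sub_self, coeff_zero, coeff_eq_zero_of_natDegree_lt (Nat.lt_succ_self _), mul_zero,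
    sub_zero, eq_comm, mul_eq_zero, mul_eq_zero] at h1
  rcases h1 with (h1 | h1) | h1
  · exact absurd h1 two_ne_zero
  · exact_mod_cast sub_eq_zero.1 h1
  · exact absurd h1 (leadingCoeff_ne_zero.2 hp)

lemma even_of_quad_ode (h : 2 * quad K * derivative p = (m : K[X]) * ((2 * X - 1) * p))
    (hp : p ≠ 0) :
    Even m := by
  by_contra hm
  rw [Nat.not_even_iff_odd] at hm
  obtain ⟨q, rfl⟩ := hm
  apply hp
  ext k
  rw [coeff_zero]
  induction k with
  | zero =>
    have h1 := congrArg (coeff · 0) h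
    have h2 : ((2 * q + 1 : ℕ) : K) ≠ 0 := Nat.cast_ne_zero.2 (by lia)
    simp only [quad, mul_coeff_zero, coeff_sub, coeff_X_zero, coeff_one_zero, coeff_X_pow,
      coeff_natCast_ite] at h1
    simp at h1
    simpa using h1.resolve_left (by exact_mod_cast h2)
  | succ k ih =>
    have h1 := coeff_quad_ode (2 * q + 1) k p
    rw [h, sub_self, coeff_zero, ih, mul_zero, zero_sub, eq_comm, neg_eq_zero, mul_eq_zero] at h1
    refine h1.resolve_left fun h2 => ?_
    have h3 : ((2 * (k : ℤ) + 2 - (2 * q + 1) : ℤ) : K) = 0 := by push_cast at h2 ⊢; exact h2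
    rw [Int.cast_eq_zero] at h3
    lia

lemma eq_of_quad_ode {q : ℕ} (h : 2 * quad K * derivative p = ((2 * q : ℕ) : K[X]) * ((2 * X - 1) * p)) :
    p = C (p.coeff (2 * q)) * quad K ^ q := by
  have hq : (quad K ^ q).natDegree = 2 * q := by
    rw [quad_monic.natDegree_pow, natDegree_quad, mul_comm]
  have hc : (quad K ^ q).coeff (2 * q) = 1 := by
    rw [← hq]
    exact (quad_monic.pow q).coeff_natDegree
  by_contra hne
  have hne' := sub_ne_zero.2 hne
  have h1 : 2 * quad K * derivative (p - C (p.coeff (2 * q)) * quad K ^ q) =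
      ((2 * q : ℕ) : K[X]) * ((2 * X - 1) * (p - C (p.coeff (2 * q)) * quad K ^ q)) := by
    have := quad_ode_pow (K := K) q
    rw [derivative_sub, derivative_C_mul]
    linear_combination h - C (p.coeff (2 * q)) * this
  have h2 := leadingCoeff_ne_zero.2 hne'
  rw [leadingCoeff, natDegree_of_quad_ode h1 hne', coeff_sub, coeff_C_mul, hc] at h2
  simp at h2

end ode

lemma coeffDer_quad_pow (δ : Derivation ℤ K K) (q : ℕ) : coeffDer δ (quad K ^ q) = 0 := by
  have : coeffDer δ (quad K) = 0 := by
    rw [quad, map_sub, Derivation.leibniz_pow, coeffDer_X]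
    simp
  rw [Derivation.leibniz_pow, this, smul_zero, smul_zero]

variable {δ : Derivation ℤ K K} {t a b e g : K} {F : K[X][X]}

lemma sysDer_rot_eq (ht : δ t = t) (t_ne : t ≠ 0) (h : sysDer δ t a b e F = C (C g) * F) :
    sysDer δ (-t) (-(a + 1)) (-e) (-b) (rot t F) = C (C g) * rot t F := by
  rw [← rot_sysDer ht t_ne, h, map_mul, rot, evalAt_C_C]
  rfl

variable [CharZero K]

lemma coeff_natDegree_eq_of_sysDer (h : sysDer δ t a b e F = C (C g) * F) (hF : F ≠ 0) :
    ∃ q, F.natDegree = 2 * q ∧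
      F.coeff (2 * q) = C ((F.coeff (2 * q)).coeff (2 * q)) * quad K ^ q := by
  have h1 := coeff_sysDer_succ δ t a b e F F.natDegree
  have hz : ∀ i, F.natDegree < i → F.coeff i = 0 := fun i hi => coeff_eq_zero_of_natDegree_lt hi
  rw [h, coeff_C_mul, hz _ (by lia), hz (F.natDegree + 2) (by lia)] at h1
  simp only [map_zero, mul_zero, zero_add, add_zero, sub_zero] at h1
  have h2 : 2 * quad K * derivative (F.coeff F.natDegree) =
      (F.natDegree : K[X]) * ((2 * X - 1) * F.coeff F.natDegree) := by
    linear_combination -h1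
  obtain ⟨q, hq⟩ := even_of_quad_ode h2 (leadingCoeff_ne_zero.2 hF)
  rw [← two_mul] at hq
  rw [hq] at h2
  exact ⟨q, hq, eq_of_quad_ode h2⟩

lemma coeff_coeff_of_sysDer {q : ℕ} (h : sysDer δ t a b e F = C (C g) * F)
    (hx : F.natDegree = 2 * (q + 1)) (hy : degY F ≤ 2 * (q + 1))
    (htop : F.coeff (2 * (q + 1)) = quad K ^ (q + 1)) :
    (F.coeff (2 * q + 1)).coeff (2 * q + 1) = (q + 1) * (a - (q + 1) * t) := by
  have hqd : ∀ i, (quad K ^ i).natDegree = 2 * i := fun i => by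
    rw [quad_monic.natDegree_pow, natDegree_quad, mul_comm]
  have hqc : ∀ i, (quad K ^ i).coeff (2 * i) = 1 := fun i => by
    rw [← hqd]
    exact (quad_monic.pow i).coeff_natDegree
  set P := C t * quad K + C a * X + C b with hP
  have h1 := coeff_sysDer_succ δ t a b e F (2 * q + 1)
  rw [h, coeff_C_mul, coeff_eq_zero_of_natDegree_lt (show F.natDegree < 2 * q + 1 + 2 by lia),
    show 2 * q + 1 + 1 = 2 * (q + 1) by ring, htop, coeffDer_quad_pow, derivative_pow_succ,
    derivative_quad] at h1
  have hPd : derivative P = C t * (2 * X - 1) + C a := by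
    simp [hP, derivative_quad]
  set p := F.coeff (2 * q + 1) - C ((q : K) + 1) * (quad K ^ q * P) with hp
  have hode := quad_ode_pow (K := K) q
  have h2 : 2 * quad K * derivative p - ((2 * q + 1 : ℕ) : K[X]) * ((2 * X - 1) * p) =
      C g * quad K ^ (q + 1) := by
    rw [hp, derivative_sub, derivative_C_mul, derivative_mul, hPd]
    rw [← hP] at h1
    simp only [map_add, map_natCast, C_1] at h1 ⊢
    push_cast at *
    linear_combination -h1 - ((q : K[X]) + 1) * P * hode
  have hdp : p.natDegree ≤ 2 * q + 2 := by
    have hPdeg : P.natDegree ≤ 2 := by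
      rw [hP, quad]
      compute_degree
    refine (natDegree_sub_le _ _).trans (max_le ((natDegree_coeff_le F _).trans hy) ?_)
    refine (natDegree_C_mul_le _ _).trans (natDegree_mul_le.trans ?_)
    rw [hqd]
    lia
  have h3 := coeff_quad_ode (2 * q + 1) (2 * q + 2) p
  rw [h2, coeff_C_mul, coeff_eq_zero_of_natDegree_lt (show (quad K ^ (q + 1)).natDegree < _ by
    rw [hqd]; lia), coeff_eq_zero_of_natDegree_lt (show p.natDegree < 2 * q + 2 + 1 by lia)] at h3
  have h4 := coeff_quad_ode (2 * q + 1) (2 * q + 1) p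
  rw [h2, coeff_C_mul, show 2 * q + 1 + 1 = 2 * (q + 1) by ring, hqc] at h4
  have h5 : p.coeff (2 * (q + 1)) = 0 := by
    push_cast at h3
    rw [show 2 * (q + 1) = 2 * q + 2 by ring]
    linear_combination (-1 / 2 : K) * h3
  have hg : g = 0 := by
    rw [h5] at h4
    linear_combination h4
  have hp0 : p = 0 := by
    by_contra hne
    rw [hg, C_0, zero_mul] at h2
    have := even_of_quad_ode (sub_eq_zero.1 h2) hne
    rw [Nat.even_add_one] at this
    exact this (even_two_mul q)
  rw [sub_eq_zero.1 hp0, hP, coeff_C_mul]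
  have h6 : (quad K ^ (q + 1)).coeff (2 * q + 1) = -(q + 1) := by
    have h : quad K ^ (q + 1) = (X + C (-1)) ^ (q + 1) * X ^ (q + 1) := by
      rw [← mul_pow, quad, C_neg, C_1]
      ring
    rw [h, show 2 * q + 1 = q + (q + 1) by ring, coeff_mul_X_pow, coeff_X_add_C_pow]
    simp
  have h7 : (quad K ^ q).coeff (2 * q + 1) = 0 :=
    coeff_eq_zero_of_natDegree_lt (by rw [hqd]; lia)
  have h8 : quad K ^ q * (C t * quad K + C a * X + C b) =
      C t * quad K ^ (q + 1) + C a * (quad K ^ q * X) + C b * quad K ^ q := by ring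
  rw [h8, coeff_add, coeff_add, coeff_C_mul, coeff_C_mul, coeff_C_mul, coeff_mul_X, h6, h7, hqc]
  ring

lemma coeff_ne_quad_pow (ht : δ t = t) (t_ne : t ≠ 0) {q : ℕ}
    (h : sysDer δ t a b e F = C (C g) * F) (hx : F.natDegree = 2 * (q + 1))
    (hy : degY F = 2 * (q + 1)) : F.coeff (2 * (q + 1)) ≠ quad K ^ (q + 1) := by
  intro htop
  have hF : F ≠ 0 := by
    rintro rfl
    simp at hx
  have h' := sysDer_rot_eq ht t_ne h
  have hq : ((q : K) + 1) ≠ 0 := by exact_mod_cast q.succ_ne_zero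
  have htt : t⁻¹ * -t = -1 := by
    field_simp
  have hqc : (quad K ^ (q + 1)).coeff (2 * (q + 1)) = 1 := by
    have := (quad_monic (K := K).pow (q + 1)).coeff_natDegree
    rwa [quad_monic.natDegree_pow, natDegree_quad, mul_comm] at this
  obtain ⟨r, hr, hrF⟩ := coeff_natDegree_eq_of_sysDer h' (rot_ne_zero t_ne hF)
  rw [degY_eq_natDegree_rot t_ne, hy] at hr
  obtain rfl : r = q + 1 := by lia
  rw [coeff_coeff_rot, htop, hqc, one_mul, ← mul_pow, htt, Even.neg_one_pow (even_two_mul _), C_1,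
    one_mul] at hrF
  have c1 := coeff_coeff_of_sysDer h hx hy.le htop
  have c2 := coeff_coeff_of_sysDer h' (by rw [degY_eq_natDegree_rot t_ne, hy])
    (by rw [natDegree_eq_degY_rot t_ne, hx]) hrF
  rw [coeff_coeff_rot, c1, mul_assoc, ← mul_pow, htt, Odd.neg_one_pow (odd_two_mul_add_one q)]
    at c2
  exact hq (by linear_combination c2)

lemma natDegree_eq_zero_of_sysDer (ht : δ t = t) (t_ne : t ≠ 0) (hF : F ≠ 0)
    (h : sysDer δ t a b e F = C (C g) * F) : F.natDegree = 0 ∧ degY F = 0 := by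
  have hqd : ∀ {c : K} (_ : c ≠ 0) i, (C c * quad K ^ i).natDegree = 2 * i := fun hc i => by
    rw [natDegree_C_mul hc, quad_monic.natDegree_pow, natDegree_quad, mul_comm]
  have hle : ∀ {G : K[X][X]}, G ≠ 0 → ∀ {q}, G.natDegree = 2 * q →
      G.coeff (2 * q) = C ((G.coeff (2 * q)).coeff (2 * q)) * quad K ^ q →
      (G.coeff (2 * q)).coeff (2 * q) ≠ 0 ∧ 2 * q ≤ degY G := by
    intro G hG q hq hqG
    have h0 : (G.coeff (2 * q)).coeff (2 * q) ≠ 0 := by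
      intro h0
      rw [h0, C_0, zero_mul, ← hq] at hqG
      exact hG (leadingCoeff_eq_zero.1 hqG)
    refine ⟨h0, ?_⟩
    have := natDegree_coeff_le G (2 * q)
    rwa [hqG, hqd h0] at this
  obtain ⟨q, hq, hqF⟩ := coeff_natDegree_eq_of_sysDer h hF
  obtain ⟨r, hr, hrF⟩ :=
    coeff_natDegree_eq_of_sysDer (sysDer_rot_eq ht t_ne h) (rot_ne_zero t_ne hF)
  obtain ⟨h0, h1⟩ := hle hF hq hqF
  obtain ⟨-, h2⟩ := hle (rot_ne_zero t_ne hF) hr hrF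
  rw [degY_eq_natDegree_rot t_ne] at hr
  rw [natDegree_eq_degY_rot t_ne] at h2
  have hqr : degY F = 2 * q := by lia
  rcases q with _ | q
  · exact ⟨hq, hqr⟩
  exfalso
  set β := (F.coeff (2 * (q + 1))).coeff (2 * (q + 1)) with hβ
  have hC : (C (C β⁻¹) : K[X][X]) ≠ 0 := by simpa using h0
  have hder : sysDer δ t a b e (C (C β⁻¹) * F) =
      C (C (g + β * δ β⁻¹)) * (C (C β⁻¹) * F) := by
    have hββ : (C (C β) * C (C β⁻¹) : K[X][X]) = 1 := by
      rw [← C_mul, ← C_mul, mul_inv_cancel₀ h0, C_1, C_1]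
    rw [Derivation.leibniz, h, sysDer_C_C]
    simp only [smul_eq_mul, C_add, C_mul]
    linear_combination -F * C (C (δ β⁻¹)) * hββ
  refine coeff_ne_quad_pow (q := q) ht t_ne hder ?_ ?_ ?_
  · rw [natDegree_C_mul (by simpa using h0), hq]
  · rw [degY_mul hC hF, degY_C, natDegree_C, zero_add, hqr]
  · rw [coeff_C_mul, hqF, ← mul_assoc, ← C_mul, inv_mul_cancel₀ h0, C_1, one_mul]

end

section

variable {K : Type*} [Field K] {L : Type*} [Field L] [Algebra K L]
variable {δ : Derivation ℤ K K} {η : Derivation ℤ L L} {t a b e : K} {y x : L} {F : K[X][X]}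

/-- For non-integral parameters there is no dependent solution. -/
theorem DependentSolution.not_nonint [CharZero K]
    (hδ : ∀ k, η (algebraMap K L k) = algebraMap K L (δ k))
    (h : DependentSolution δ η t a b e y x F) : ¬ Nonint a b e := by
  intro hp
  classical
  let P : ℕ → Prop := fun N => ∃ (t a b e : K) (y x : L) (F : K[X][X]),
    DependentSolution δ η t a b e y x F ∧ Nonint a b e ∧ F.natDegree + degY F = N
  have hP : ∃ N, P N := ⟨_, t, a, b, e, y, x, F, h, hp, rfl⟩
  obtain ⟨t, a, b, e, y, x, F, h, hp, hN⟩ := Nat.find_spec hP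
  have hlow : IsLowerBound δ η (Nat.find hP) := fun t a b e y x F h hp =>
    Nat.find_min' hP ⟨t, a, b, e, y, x, F, h, hp, rfl⟩
  obtain ⟨g, hg⟩ := exists_sysDer_eq_const_mul hδ hlow h hp hN.le
  obtain ⟨h1, h2⟩ := natDegree_eq_zero_of_sysDer h.der_t h.t_ne h.ne_zero hg
  exact ((isUnit_of_natDegree_eq_zero h.ne_zero h1 h2).map (evalAt y x)).ne_zero h.eval_eq_zero

lemma algebraicIndependent_iff_evalAt {A : Type*} [CommRing A] [Algebra K A] {y x : A} :
    AlgebraicIndependent K ![y, x] ↔ ∀ F : K[X][X], evalAt y x F = 0 → F = 0 := by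
  have key : ∀ F : K[X][X],
      MvPolynomial.aeval ![y, x] (Polynomial.Bivariate.equivMvPolynomial K F) = evalAt y x F := by
    intro F
    induction F using bivariate_induction with
    | hadd F G hF hG => simp [hF, hG]
    | hmul F G hF hG => rw [map_mul, map_mul, map_mul, hF, hG]
    | hC c => simp
    | hy => simp
    | hx => simp
  rw [algebraicIndependent_iff]
  constructor
  · intro h F hF
    rw [← key] at hF
    simpa using h _ hF
  · intro h p hp
    have := h ((Polynomial.Bivariate.equivMvPolynomial K).symm p) (by rw [← key]; simpa using hp)
    simpa using this

lemma not_algebraicIndependent_iff {A : Type*} [CommRing A] [Algebra K A] {y x : A} :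
    ¬ AlgebraicIndependent K ![y, x] ↔ ∃ F : K[X][X], F ≠ 0 ∧ evalAt y x F = 0 := by
  rw [algebraicIndependent_iff_evalAt]
  push Not
  simp only [and_comm]

end

section

/-- A derivation of a domain extends to its fraction field. -/
lemma exists_derivation_fractionRing {A Q : Type*} [CommRing A] [IsDomain A] [Algebra ℤ A] [Field Q]
    [Algebra A Q] [IsFractionRing A Q] (d : Derivation ℤ A A) :
    ∃ D : Derivation ℤ Q Q, ∀ r, D (algebraMap A Q r) = algebraMap A Q (d r) := by
  let φ : A →+* DualNumber Q :=
    { toFun := fun r => TrivSqZeroExt.inl (algebraMap A Q r) + TrivSqZeroExt.inr (algebraMap A Q (d r))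
      map_one' := by ext <;> simp
      map_zero' := by ext <;> simp
      map_add' := fun r s => by
        ext <;> simp only [TrivSqZeroExt.fst_add, TrivSqZeroExt.snd_add, TrivSqZeroExt.fst_inl,
          TrivSqZeroExt.snd_inl, TrivSqZeroExt.fst_inr, TrivSqZeroExt.snd_inr, map_add] <;> ring
      map_mul' := fun r s => by
        ext <;> simp only [TrivSqZeroExt.fst_add, TrivSqZeroExt.snd_add, TrivSqZeroExt.fst_inl,
          TrivSqZeroExt.snd_inl, TrivSqZeroExt.fst_inr, TrivSqZeroExt.snd_inr, map_add, map_mul,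
          TrivSqZeroExt.fst_mul, TrivSqZeroExt.snd_mul, Derivation.leibniz, smul_eq_mul,
          MulOpposite.smul_eq_mul_unop, MulOpposite.unop_op] <;> ring }
  have hφ : ∀ s : nonZeroDivisors A, IsUnit (φ s) := fun s => by
    rw [TrivSqZeroExt.isUnit_iff_isUnit_fst]
    simp [φ]
  let ψ : Q →+* DualNumber Q := IsLocalization.lift hφ
  have hψ : ∀ r, ψ (algebraMap A Q r) = φ r := IsLocalization.lift_eq hφ
  have hfst : ∀ z, (ψ z).fst = z := by
    intro z
    have : (TrivSqZeroExt.fstHom ℤ Q Q).toRingHom.comp ψ = RingHom.id Q := by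
      refine IsLocalization.ringHom_ext (nonZeroDivisors A) (RingHom.ext fun r => ?_)
      simp [hψ, φ]
    exact congrArg (fun f => f z) this
  have hsnd : ∀ r, (ψ (algebraMap A Q r)).snd = algebraMap A Q (d r) := by
    intro r
    rw [hψ]
    change (TrivSqZeroExt.inl (algebraMap A Q r) +
      TrivSqZeroExt.inr (algebraMap A Q (d r)) : DualNumber Q).snd = _
    rw [TrivSqZeroExt.snd_add, TrivSqZeroExt.snd_inl, TrivSqZeroExt.snd_inr, zero_add]
  refine ⟨Derivation.mk' ((TrivSqZeroExt.sndHom Q Q).toAddMonoidHom.comp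
    ψ.toAddMonoidHom).toIntLinearMap fun r s => ?_, hsnd⟩
  change (ψ (r * s)).snd = r * (ψ s).snd + s * (ψ r).snd
  rw [map_mul, TrivSqZeroExt.snd_mul, hfst, hfst, smul_eq_mul, MulOpposite.smul_eq_mul_unop,
    MulOpposite.unop_op, mul_comm s]

/-- Over some differential field (in the universe `u`), the system with parameter `v` has a
dependent solution. -/
def Exceptional.{u} (v₁ v₂ v₃ v₄ : ℂ) : Prop :=
  ∃ (L : Type u) (_ : Field L) (K : Type u) (_ : Field K) (_ : Algebra K L) (ι : ℂ →+* K)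
    (δ : Derivation ℤ K K) (η : Derivation ℤ L L) (t : K) (y x : L) (F : K[X][X]),
    (∀ k, η (algebraMap K L k) = algebraMap K L (δ k)) ∧ (∀ c, δ (ι c) = 0) ∧
      DependentSolution δ η t (ι (v₁ - v₂ - v₃ + v₄)) (ι (v₂ - v₁)) (ι (v₃ - v₁)) y x F

universe u

variable {v₁ v₂ v₃ v₄ : ℂ}

lemma exceptional_of_isFractionRing {k K L : Type u} [Field k] [Field K] [Algebra k[X] K]
    [IsFractionRing k[X] K] [Field L] [Algebra K[X] L] [IsFractionRing K[X] L] (ι : ℂ →+* k)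
    (v w z : ℂ) : Exceptional.{u} v v w z := by
  let _ : Algebra K L := ((algebraMap K[X] L).comp C).toAlgebra
  have hKL : ∀ c, algebraMap K L c = algebraMap K[X] L (C c) := fun _ => rfl
  let κ : ℂ →+* K := (algebraMap k[X] K).comp (C.comp ι)
  let t : K := algebraMap k[X] K X
  obtain ⟨δ, hδ⟩ := exists_derivation_fractionRing (Q := K) ((X : k[X]) • polyDer k)
  obtain ⟨η, hη⟩ := exists_derivation_fractionRing (Q := L) (coeffDer δ +
    (X ^ 2 + C t * X - C (κ (v - v - w + z)) * X + C (κ (w - v) * t)) • polyDer K)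
  have hηC : ∀ c, η (algebraMap K L c) = algebraMap K L (δ c) := fun c => by
    rw [hKL, hη, Derivation.add_apply, Derivation.smul_apply, coeffDer_C, polyDer_apply,
      derivative_C, smul_zero, add_zero, hKL]
  have hδκ : ∀ c, δ (κ c) = 0 := fun c => by
    change δ (algebraMap k[X] K (C (ι c))) = 0
    rw [hδ, Derivation.smul_apply, polyDer_apply, derivative_C, smul_zero, map_zero]
  refine ⟨L, inferInstance, K, inferInstance, inferInstance, κ, δ, η, t, 0, algebraMap K[X] L X,
    C X, hηC, hδκ, ?_, ?_, hδκ _, hδκ _, hδκ _, ?_, ?_, ?_, ?_, ?_⟩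
  · rw [hδ, Derivation.smul_apply, polyDer_apply, derivative_X, smul_eq_mul, mul_one]
  · exact (map_ne_zero_iff _ (IsFractionRing.injective k[X] K)).2 X_ne_zero
  · simp
  · rw [hη, Derivation.add_apply, Derivation.smul_apply, coeffDer_X, polyDer_apply, derivative_X,
      smul_eq_mul, mul_one, zero_add]
    simp only [hKL, map_add, map_sub, map_mul, map_pow]
    ring
  · rintro ⟨-, p, hp, hpX⟩
    have h : aeval (algebraMap K[X] L X) p = algebraMap K[X] L p := by
      rw [aeval_def, RingHom.algebraMap_toAlgebra, ← hom_eval₂ p C (algebraMap K[X] L) X, eval₂_C_X]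
    rw [h] at hpX
    exact hp ((map_eq_zero_iff _ (IsFractionRing.injective K[X] L)).1 hpX)
  · simp
  · simp

lemma exceptional_of_eq (v w z : ℂ) : Exceptional.{u} v v w z :=
  exceptional_of_isFractionRing (K := FractionRing (ULift.{u} ℂ)[X])
    (L := FractionRing (FractionRing (ULift.{u} ℂ)[X])[X]) ULift.ringEquiv.symm.toRingHom v w z

lemma Exceptional.swap₁₂ (h : Exceptional.{u} v₁ v₂ v₃ v₄) : Exceptional.{u} v₂ v₁ v₃ v₄ := by
  obtain ⟨L, _, K, _, _, ι, δ, η, t, y, x, F, hδ, hι, h⟩ := h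
  by_cases hv : v₁ = v₂
  · subst hv
    exact ⟨L, _, K, _, _, ι, δ, η, t, y, x, F, hδ, hι, h⟩
  have hb : ι (v₂ - v₁) ≠ 0 := (map_ne_zero ι).2 (sub_ne_zero.2 (Ne.symm hv))
  obtain ⟨G, -, h', -⟩ := h.reflect hδ hb
  refine ⟨L, _, K, _, _, ι, δ, η, t, y, x - algebraMap K L (ι (v₂ - v₁)) / y, G, hδ, hι, ?_⟩
  convert h' using 1 <;> simp only [map_add, map_sub] <;> ring

lemma Exceptional.refl (h : Exceptional.{u} v₁ v₂ v₃ v₄) :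
    Exceptional.{u} (-v₃) (-v₄) (-v₁) (-v₂) := by
  obtain ⟨L, _, K, _, _, ι, δ, η, t, y, x, F, hδ, hι, h⟩ := h
  refine ⟨L, _, K, _, _, ι, δ, η, -t, 1 - y, -x, PainleveV.refl F, hδ, hι, ?_⟩
  convert h.refl using 1 <;> simp only [map_add, map_sub, map_neg] <;> ring

lemma Exceptional.rot (h : Exceptional.{u} v₁ v₂ v₃ v₄) :
    Exceptional.{u} (-v₁) (-v₃) (-v₂) (-v₄ - 1) := by
  obtain ⟨L, _, K, _, _, ι, δ, η, t, y, x, F, hδ, hι, h⟩ := h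
  refine ⟨L, _, K, _, _, ι, δ, η,
      -t, algebraMap K L (-t⁻¹) * x, algebraMap K L t * y, PainleveV.rot t F, hδ, hι, ?_⟩
  convert h.rot hδ using 1 <;> simp only [map_add, map_sub, map_neg, map_one] <;> ring

lemma Exceptional.swap₃₄ (h : Exceptional.{u} v₁ v₂ v₃ v₄) : Exceptional.{u} v₁ v₂ v₄ v₃ := by
  simpa using h.refl.swap₁₂.refl

lemma Exceptional.swap₁₃ (h : Exceptional.{u} v₁ v₂ v₃ v₄) : Exceptional.{u} v₃ v₂ v₁ v₄ := by
  simpa using h.rot.swap₁₂.rot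

lemma Exceptional.sub_one (h : Exceptional.{u} v₁ v₂ v₃ v₄) :
    Exceptional.{u} v₁ (v₂ - 1) v₃ v₄ := by
  simpa using h.refl.rot.swap₃₄.swap₁₃.swap₁₂

lemma Exceptional.add_one (h : Exceptional.{u} v₁ v₂ v₃ v₄) :
    Exceptional.{u} v₁ (v₂ + 1) v₃ v₄ := by
  simpa [add_comm] using h.swap₁₂.swap₁₃.swap₃₄.rot.refl

lemma exceptional_of_sub_eq_int {n : ℤ} (h : v₁ - v₂ = n) : Exceptional.{u} v₁ v₂ v₃ v₄ := by
  obtain rfl : v₂ = v₁ + (-n : ℤ) := by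
    push_cast
    linear_combination -h
  clear h
  induction -n using Int.induction_on with
  | zero => simpa using exceptional_of_eq v₁ v₃ v₄
  | succ k ih =>
    convert ih.add_one using 1
    push_cast
    ring
  | pred k ih =>
    convert ih.sub_one using 1
    push_cast
    ring

end

section

universe u

/-- An exceptional parameter violates the dichotomy for strong minimality. -/
lemma Exceptional.exists_dependent {v₁ v₂ v₃ v₄ : ℂ} (h : Exceptional.{u} v₁ v₂ v₃ v₄) :
    ∃ (L : Type u) (_ : Field L) (_ : Algebra ℂ L) (D : L → L),
      (∀ a b : L, D (a + b) = D a + D b) ∧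
      (∀ a b : L, D (a * b) = a * D b + b * D a) ∧
      (∀ c : ℂ, D (algebraMap ℂ L c) = 0) ∧
      ∃ t : L, D t = 1 ∧
      ∃ K : Subfield L,
        (∀ c : ℂ, algebraMap ℂ L c ∈ K) ∧ t ∈ K ∧ (∀ a ∈ K, D a ∈ K) ∧
      ∃ y x : L,
        t * D y = 2 * y ^ 2 * x - 2 * y * x + t * y ^ 2 - t * y
            + algebraMap ℂ L (v₁ - v₂ - v₃ + v₄) * y + algebraMap ℂ L (v₂ - v₁) ∧
        t * D x = -(2 * y * x ^ 2) + x ^ 2 - 2 * t * x * y + t * x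
            - algebraMap ℂ L (v₁ - v₂ - v₃ + v₄) * x + algebraMap ℂ L (v₃ - v₁) * t ∧
        ¬ ((IsAlgebraic K y ∧ IsAlgebraic K x) ∨ AlgebraicIndependent K ![y, x]) := by
  obtain ⟨L, _, K, _, _, ι, δ, η, t, y, x, F, hδ, hι, h⟩ := h
  let _ : Algebra ℂ L := ((algebraMap K L).comp ι).toAlgebra
  have hC : ∀ c, algebraMap ℂ L c = algebraMap K L (ι c) := fun _ => rfl
  have ht : algebraMap K L t ≠ 0 := (_root_.map_ne_zero _).2 h.t_ne
  let K' : Subfield L := (algebraMap K L).fieldRange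
  let φ : K →+* K' := (algebraMap K L).rangeRestrictField
  have hφ : Function.Bijective φ := (algebraMap K L).rangeRestrictField_bijective
  have hφL : ∀ k, ((φ k : K') : L) = algebraMap K L k := fun _ => rfl
  refine ⟨L, _, _, fun z => (algebraMap K L t)⁻¹ * η z, fun a b => ?_, fun a b => ?_, fun c => ?_,
    algebraMap K L t, ?_, K', fun c => ⟨ι c, rfl⟩, ⟨t, rfl⟩, ?_, y, x, ?_, ?_, ?_⟩
  · beta_reduce
    rw [map_add, mul_add]
  · beta_reduce
    rw [Derivation.leibniz, smul_eq_mul, smul_eq_mul]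
    ring
  · beta_reduce
    rw [hC, hδ, hι, map_zero, mul_zero]
  · beta_reduce
    rw [hδ, h.der_t, inv_mul_cancel₀ ht]
  · rintro _ ⟨k, rfl⟩
    exact ⟨t⁻¹ * δ k, by beta_reduce; rw [map_mul, map_inv₀, hδ]⟩
  · rw [mul_inv_cancel_left₀ ht, h.der_y, hC, hC]
  · rw [mul_inv_cancel_left₀ ht, h.der_x, hC, hC, map_mul]
  · have hcomp : (algebraMap K' L).comp φ = algebraMap K L := RingHom.ext hφL
    rintro (⟨hy, hx⟩ | hind)
    · exact h.not_algebraic ⟨hy.of_ringHom_of_comp_eq φ (RingHom.id L) hφ.2 Function.injective_id hcomp,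
        hx.of_ringHom_of_comp_eq φ (RingHom.id L) hφ.2 Function.injective_id hcomp⟩
    · refine not_algebraicIndependent_iff.2 ⟨F, h.ne_zero, h.eval_eq_zero⟩ ?_
      exact AlgebraicIndependent.of_ringHom_of_comp_eq φ (RingHom.id L) hind hφ.1 hcomp

end

end

end PainleveV

/-- Corollary 3.14: the solution set of the Hamiltonian system `S_V(v)` (Okamoto's
Hamiltonian form of the fifth Painlevé equation, with `v₁ + v₂ + v₃ + v₄ = 0`) is strongly
minimal (expressed via the dichotomy on solutions `(y,x)`) if and only if `vᵢ − vⱼ ∉ ℤ`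
for all `1 ≤ i < j ≤ 4`. -/
theorem painleveV_system_strongly_minimal_iff
    (v₁ v₂ v₃ v₄ : ℂ) (hsum : v₁ + v₂ + v₃ + v₄ = 0) :
    (∀ (L : Type*) [Field L] [Algebra ℂ L] (D : L → L),
      (∀ a b : L, D (a + b) = D a + D b) →
      (∀ a b : L, D (a * b) = a * D b + b * D a) →
      (∀ c : ℂ, D (algebraMap ℂ L c) = 0) →
      ∀ t : L, D t = 1 →
      ∀ K : Subfield L,
        (∀ c : ℂ, algebraMap ℂ L c ∈ K) → t ∈ K → (∀ a ∈ K, D a ∈ K) →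
      ∀ y x : L,
        t * D y = 2 * y ^ 2 * x - 2 * y * x + t * y ^ 2 - t * y
            + algebraMap ℂ L (v₁ - v₂ - v₃ + v₄) * y + algebraMap ℂ L (v₂ - v₁) →
        t * D x = -(2 * y * x ^ 2) + x ^ 2 - 2 * t * x * y + t * x
            - algebraMap ℂ L (v₁ - v₂ - v₃ + v₄) * x + algebraMap ℂ L (v₃ - v₁) * t →
        ((IsAlgebraic K y ∧ IsAlgebraic K x) ∨ AlgebraicIndependent K ![y, x]))
    ↔ ((¬ ∃ n : ℤ, v₁ - v₂ = (n : ℂ)) ∧ (¬ ∃ n : ℤ, v₁ - v₃ = (n : ℂ)) ∧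
        (¬ ∃ n : ℤ, v₁ - v₄ = (n : ℂ)) ∧ (¬ ∃ n : ℤ, v₂ - v₃ = (n : ℂ)) ∧
        (¬ ∃ n : ℤ, v₂ - v₄ = (n : ℂ)) ∧ (¬ ∃ n : ℤ, v₃ - v₄ = (n : ℂ))) := by
  constructor
  · intro h
    have hne : ¬ PainleveV.Exceptional v₁ v₂ v₃ v₄ := by
      intro hv
      obtain ⟨L, _, _, D, hadd, hmul, hC, t, ht, K, hK, htK, hDK, y, x, hy, hx, hyx⟩ :=
        hv.exists_dependent
      exact hyx (h L D hadd hmul hC t ht K hK htK hDK y x hy hx)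
    refine ⟨?_, ?_, ?_, ?_, ?_, ?_⟩ <;> rintro ⟨n, hn⟩ <;> apply hne
    · exact PainleveV.exceptional_of_sub_eq_int hn
    · exact (PainleveV.exceptional_of_sub_eq_int hn).swap₁₂.swap₁₃.swap₁₂
    · exact (PainleveV.exceptional_of_sub_eq_int hn).swap₁₂.swap₁₃.swap₁₂.swap₃₄
    · exact (PainleveV.exceptional_of_sub_eq_int hn).swap₁₂.swap₁₃
    · exact (PainleveV.exceptional_of_sub_eq_int hn).swap₁₂.swap₁₃.swap₃₄
    · exact (PainleveV.exceptional_of_sub_eq_int hn).swap₁₃.swap₁₂.swap₁₃.swap₃₄.swap₁₃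
  · rintro ⟨h₁₂, h₁₃, h₁₄, h₂₃, h₂₄, h₃₄⟩ L _ _ D hadd hmul hC t ht K hK htK hDK y x hy hx
    have hDt : ∀ a b : L, t * D (a * b) = a * (t * D b) + b * (t * D a) := fun a b => by
      rw [hmul]
      ring
    let η : Derivation ℤ L L := Derivation.mk'
      (AddMonoidHom.mk' (fun z => t * D z) fun a b => by rw [hadd, mul_add]).toIntLinearMap hDt
    let δ : Derivation ℤ K K := Derivation.mk'
      (AddMonoidHom.mk' (fun z : K => (⟨t * D z, K.mul_mem htK (hDK z z.2)⟩ : K)) fun a b =>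
        Subtype.ext (by simp [hadd, mul_add])).toIntLinearMap
      fun a b => Subtype.ext (hDt a b)
    let ι : ℂ →+* K := (algebraMap ℂ L).codRestrict K hK
    have hη : ∀ z, η z = t * D z := fun _ => rfl
    have hδ : ∀ k, ((δ k : K) : L) = t * D k := fun _ => rfl
    have hι : ∀ c, ((ι c : K) : L) = algebraMap ℂ L c := fun _ => rfl
    have hδι : ∀ c, δ (ι c) = 0 := fun c => Subtype.ext (by simp [hδ, hι, hC])
    have : CharZero K := charZero_of_injective_ringHom ι.injective
    have hint : PainleveV.Nonint (ι (v₁ - v₂ - v₃ + v₄)) (ι (v₂ - v₁)) (ι (v₃ - v₁)) := by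
      intro n
      simp only [← map_add, ← map_sub, ← map_intCast ι n, ne_eq, ι.injective.eq_iff]
      refine ⟨fun h => h₁₂ ⟨-n, ?_⟩, fun h => h₁₃ ⟨-n, ?_⟩, fun h => h₁₄ ⟨-n, ?_⟩,
        fun h => h₂₃ ⟨-n, ?_⟩, fun h => h₂₄ ⟨-n, ?_⟩, fun h => h₃₄ ⟨-n, ?_⟩⟩
      all_goals
        push_cast
        linear_combination -h
    rw [or_iff_not_imp_left]
    intro hyx
    by_contra hind
    obtain ⟨F, hF, hF0⟩ := PainleveV.not_algebraicIndependent_iff.1 hind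
    refine PainleveV.DependentSolution.not_nonint (δ := δ) (η := η) (t := ⟨t, htK⟩) (y := y) (x := x)
      (F := F) (fun _ => rfl) ⟨?_, ?_, hδι _, hδι _, hδι _, ?_, ?_, hyx, hF, hF0⟩ hint
    · exact Subtype.ext (by rw [hδ, ht, mul_one])
    · rintro h
      obtain rfl : t = 0 := congrArg Subtype.val h
      have := hadd 0 0
      rw [add_zero, ht] at this
      simp at this
    · rw [hη, hy]
      rfl
    · rw [hη, hx, map_mul]
      change _ = -(2 * y * x ^ 2) + x ^ 2 - 2 * t * x * y + t * x
        - algebraMap ℂ L (v₁ - v₂ - v₃ + v₄) * x + algebraMap ℂ L (v₃ - v₁) * t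
      rfl
end

section
/- Let α, β, γ, δ ∈ ℂ be algebraically independent over ℚ. Let L be a differential field extension of ℂ(t) with derivation D, K a differential subfield of L, and let y ∈ L with y ≠ 0 and y ≠ 1 satisfy the fifth Painlevé equation y'' = (1/(2y) + 1/(y−1))(y')² − (1/t)y' + ((y−1)²/t²)(αy + β/y) + γy/t + δ·y(y+1)/(y−1). Then either y is algebraic over K, or y and y' are algebraically independent over K. (Strong minimality part of Proposition 3.15 for generic P_V.) -/
section InvariantCurves

open Polynomial

/-- The derivation of `R[X]` acting coefficientwise by `d` and killing `X`. -/
noncomputable def coeffDerivation {S R : Type*} [CommRing S] [CommRing R] [Algebra S R]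
    (d : Derivation S R R) :
    Derivation S R[X] R[X] :=
  PolynomialModule.equivPolynomialSelf.compDer d.mapCoeffs

@[simp]
lemma coeff_coeffDerivation {S R : Type*} [CommRing S] [CommRing R] [Algebra S R]
    (d : Derivation S R R) (p : R[X]) (i : ℕ) :
    (coeffDerivation d p).coeff i = d (p.coeff i) := rfl

@[simp]
lemma coeffDerivation_X {S R : Type*} [CommRing S] [CommRing R] [Algebra S R]
    (d : Derivation S R R) :
    coeffDerivation d X = 0 := by
  ext i
  rw [coeff_coeffDerivation, coeff_X]
  split_ifs <;> simp

@[simp]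
lemma coeffDerivation_C {S R : Type*} [CommRing S] [CommRing R] [Algebra S R]
    (d : Derivation S R R) (a : R) :
    coeffDerivation d (C a) = C (d a) := by
  ext i
  rw [coeff_coeffDerivation, coeff_C, coeff_C]
  split_ifs <;> simp

lemma map_coeffDerivation {S R R' : Type*} [CommRing S] [CommRing R] [CommRing R']
    [Algebra S R] [Algebra S R'] (d : Derivation S R R) (e : Derivation S R' R') (φ : R →+* R')
    (h : ∀ a, φ (d a) = e (φ a)) (p : R[X]) :
    (coeffDerivation d p).map φ = coeffDerivation e (p.map φ) := by
  ext i
  simp [h]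

lemma coeffDerivation_comm {S R : Type*} [CommRing S] [CommRing R] [Algebra S R]
    (d : Derivation S R R) (p : R[X]) :
    coeffDerivation d (derivative p) = derivative (coeffDerivation d p) := by
  ext i
  simp [coeff_derivative, mul_comm]

/-- `Polynomial.derivative` as a `ℤ`-derivation. -/
noncomputable def derivativeInt (R : Type*) [CommRing R] : Derivation ℤ R[X] R[X] :=
  (derivative' : Derivation R R[X] R[X]).restrictScalars ℤ

@[simp]
lemma derivativeInt_apply {R : Type*} [CommRing R] (p : R[X]) :
    derivativeInt R p = derivative p := rfl

lemma derivation_pow_mul_pow {S R : Type*} [CommRing S] [CommRing R] [Algebra S R]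
    (d : Derivation S R R) (u v : R)
    (m n : ℕ) :
    u * v * d (u ^ m * v ^ n) = (m * v * d u + n * u * d v) * (u ^ m * v ^ n) := by
  have h : ∀ (w : R) (l : ℕ), w * d (w ^ l) = l * w ^ l * d w := by
    intro w l
    rcases l with _ | l
    · simp
    · rw [Derivation.leibniz_pow]
      simp only [Nat.add_sub_cancel, smul_eq_mul, nsmul_eq_mul]
      ring
  rw [Derivation.leibniz, smul_eq_mul, smul_eq_mul]
  linear_combination u ^ m * u * h v n + v ^ n * v * h u m

section Field

variable {k : Type*} [Field k]

lemma exists_eq_pow_mul_pow_of_dvd [CharZero k] (a b : k) {p : k[X]} (hp : p ≠ 0)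
    (h : p ∣ (X - C a) * (X - C b) * derivative p) :
    ∃ (u : k) (m n : ℕ), u ≠ 0 ∧ p = C u * ((X - C a) ^ m * (X - C b) ^ n) := by
  obtain ⟨p₁, hp₁, ha⟩ := exists_eq_pow_rootMultiplicity_mul_and_not_dvd p hp a
  set m := p.rootMultiplicity a
  have hp₁0 : p₁ ≠ 0 := by rintro rfl; simp at ha
  obtain ⟨q, hq, hb⟩ := exists_eq_pow_rootMultiplicity_mul_and_not_dvd p₁ hp₁0 b
  set n := p₁.rootMultiplicity b
  have ha' : ¬ (X - C a) ∣ q := fun hd => ha (hq ▸ hd.mul_left _)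
  have hpq : p = (X - C a) ^ m * (X - C b) ^ n * q := by rw [hp₁, hq]; ring
  have hq0 : q ≠ 0 := by rintro rfl; simp at hb
  have key := derivation_pow_mul_pow (derivativeInt k) (X - C a) (X - C b) m n
  simp only [derivativeInt_apply, derivative_sub, derivative_X, derivative_C, sub_zero,
    mul_one] at key
  have h1 : (X - C a) ^ m * (X - C b) ^ n * q ∣
      (X - C a) ^ m * (X - C b) ^ n * ((X - C a) * (X - C b) * derivative q) := by
    have h2 : (X - C a) * (X - C b) * derivative p =
        ((m : k[X]) * (X - C b) + (n : k[X]) * (X - C a)) * p +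
        (X - C a) ^ m * (X - C b) ^ n * ((X - C a) * (X - C b) * derivative q) := by
      rw [hpq, derivative_mul]
      linear_combination q * key
    rw [h2] at h
    rw [← hpq]
    exact (dvd_add_right (dvd_mul_left _ _)).1 h
  have h3 : q ∣ (X - C a) * (X - C b) * derivative q := by
    refine (mul_dvd_mul_iff_left ?_).1 h1
    exact mul_ne_zero (pow_ne_zero _ (X_sub_C_ne_zero a)) (pow_ne_zero _ (X_sub_C_ne_zero b))
  have hca : IsCoprime q (X - C a) :=
    ((irreducible_X_sub_C a).coprime_iff_not_dvd.2 ha').symm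
  have hcb : IsCoprime q (X - C b) :=
    ((irreducible_X_sub_C b).coprime_iff_not_dvd.2 hb).symm
  have h4 : q ∣ derivative q := (hca.mul_right hcb).dvd_of_dvd_mul_left h3
  have h5 : derivative q = 0 := by
    by_contra hne
    have := degree_le_of_dvd h4 hne
    exact absurd (degree_derivative_lt hq0) (not_lt.2 this)
  obtain ⟨u, hu⟩ : ∃ u, q = C u := ⟨_, eq_C_of_natDegree_eq_zero (derivative_eq_zero.1 h5)⟩
  refine ⟨u, m, n, ?_, ?_⟩
  · rintro rfl
    exact hq0 (by simpa using hu)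
  · rw [hpq, hu]; ring

lemma exists_eq_pow_mul_pow_of_monic [CharZero k] {s : k} {f g : k[X]}
    (hf : f.Monic) (h : (X ^ 2 - C (s ^ 2)) * derivative f = g * f) :
    ∃ m n : ℕ, f = (X - C s) ^ m * (X + C s) ^ n := by
  obtain ⟨u, m, n, -, hfu⟩ := exists_eq_pow_mul_pow_of_dvd s (-s) hf.ne_zero
    ⟨g, by
      rw [mul_comm f g, ← h]
      simp only [map_neg, C_pow]
      ring⟩
  refine ⟨m, n, ?_⟩
  simp only [map_neg, sub_neg_eq_add] at hfu
  have hm : ((X - C s) ^ m * (X + C s) ^ n).Monic :=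
    ((monic_X_sub_C s).pow m).mul ((monic_X_add_C s).pow n)
  have h1 : u = 1 := by
    have := congrArg leadingCoeff hfu
    rw [hf.leadingCoeff, leadingCoeff_mul, hm.leadingCoeff, leadingCoeff_C, mul_one] at this
    exact this.symm
  rw [hfu, h1]
  simp

lemma nextCoeff_pow_mul_pow (s : k) (m n : ℕ) :
    ((X - C s) ^ m * (X + C s) ^ n).nextCoeff = ((n : ℤ) - m : ℤ) * s := by
  rw [((monic_X_sub_C s).pow m).nextCoeff_mul ((monic_X_add_C s).pow n),
    (monic_X_sub_C s).nextCoeff_pow, (monic_X_add_C s).nextCoeff_pow, nextCoeff_X_sub_C,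
    nextCoeff_X_add_C]
  simp only [nsmul_eq_mul]
  push_cast
  ring

lemma natDegree_pow_mul_pow (s : k) (m n : ℕ) :
    ((X - C s) ^ m * (X + C s) ^ n).natDegree = m + n := by
  rw [((monic_X_sub_C s).pow m).natDegree_mul ((monic_X_add_C s).pow n),
    natDegree_pow, natDegree_pow, natDegree_X_sub_C, natDegree_X_add_C, mul_one, mul_one]

/-- Comparison of leading coefficients in `(a X² + b) f' = (u X + v) f`. -/
lemma natDegree_eq_of_mul_derivative {a b u v : k} {f : k[X]} (hf : f ≠ 0)
    (h : (C a * X ^ 2 + C b) * derivative f = (C u * X + C v) * f) :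
    a * f.natDegree = u := by
  have h1 := congrArg (fun p => p.coeff (f.natDegree + 1)) h
  have e1 : ((C a * X ^ 2 + C b) * derivative f).coeff (f.natDegree + 1) =
      a * (f.natDegree * f.leadingCoeff) := by
    rw [add_mul, coeff_add, mul_assoc, coeff_C_mul, coeff_C_mul]
    rcases hN : f.natDegree with _ | n
    · obtain ⟨c, rfl⟩ : ∃ c, f = C c := ⟨_, eq_C_of_natDegree_eq_zero hN⟩
      simp
    · rw [show n + 1 + 1 = n + 2 from rfl, coeff_X_pow_mul, coeff_derivative, coeff_derivative,
        coeff_eq_zero_of_natDegree_lt (n := n + 2 + 1) (by omega), leadingCoeff, hN]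
      push_cast
      ring
  have e2 : ((C u * X + C v) * f).coeff (f.natDegree + 1) = u * f.leadingCoeff := by
    rw [add_mul, coeff_add, mul_assoc, coeff_C_mul, coeff_C_mul, coeff_X_mul,
      coeff_eq_zero_of_natDegree_lt (n := f.natDegree + 1) (by omega), leadingCoeff]
    ring
  simp only [e1, e2] at h1
  exact mul_right_cancel₀ (leadingCoeff_ne_zero.2 hf) (by rw [← h1]; ring)

end Field

section Operator

variable {k : Type*} [Field k]

/-- For `ϑ z = (A z² + B) / M` and `ϑ y = z`, the operator on `k[Y][Z]` expressing `M(y) • ϑ` in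
terms of polynomials in `y` and `z`, where `ϑ` extends the derivation `d` of `k`. -/
noncomputable def foliationOp (d : Derivation ℤ k k) (M A B : k[X]) (F : k[X][X]) : k[X][X] :=
  C M * (coeffDerivation (coeffDerivation d) F + X * coeffDerivation (derivativeInt k) F) +
    (C A * X ^ 2 + C B) * derivative F

lemma natDegree_coeffDerivation_le {S R : Type*} [CommRing S] [CommRing R] [Algebra S R]
    (d : Derivation S R R) (p : R[X]) : (coeffDerivation d p).natDegree ≤ p.natDegree := by
  rw [natDegree_le_iff_coeff_eq_zero]
  intro N hN
  rw [coeff_coeffDerivation, coeff_eq_zero_of_natDegree_lt hN, map_zero]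

lemma natDegree_foliationOp_le (d : Derivation ℤ k k) (M A B : k[X]) (F : k[X][X]) :
    (foliationOp d M A B F).natDegree ≤ F.natDegree + 1 := by
  have h1 := natDegree_coeffDerivation_le (coeffDerivation d) F
  have h2 := natDegree_coeffDerivation_le (derivativeInt k) F
  rcases hN : F.natDegree with _ | n
  · obtain ⟨c, rfl⟩ : ∃ c, F = C c := ⟨_, eq_C_of_natDegree_eq_zero hN⟩
    rw [foliationOp]
    simp only [coeffDerivation_C, derivative_C, mul_zero, add_zero]
    compute_degree
  · have h3 : (derivative F).natDegree ≤ n := by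
      have := natDegree_derivative_le F
      omega
    rw [hN] at h1 h2
    rw [foliationOp]
    refine natDegree_add_le_of_degree_le ?_ ?_
    · refine (natDegree_C_mul_le _ _).trans (natDegree_add_le_of_degree_le (by omega) ?_)
      refine natDegree_mul_le.trans ?_
      rw [natDegree_X]; omega
    · refine natDegree_mul_le.trans ?_
      have : (C A * X ^ 2 + C B : k[X][X]).natDegree ≤ 2 := by compute_degree
      omega

lemma exists_cofactor {d : Derivation ℤ k k} {M A B : k[X]} {F : k[X][X]} (hF : F ≠ 0)
    (h : F ∣ foliationOp d M A B F) :
    ∃ μ ν : k[X], foliationOp d M A B F = (C μ * X + C ν) * F := by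
  obtain ⟨G, hG⟩ := h
  have hG1 : G.natDegree ≤ 1 := by
    by_cases hG0 : G = 0
    · simp [hG0]
    have := natDegree_foliationOp_le d M A B F
    rw [hG, natDegree_mul hF hG0] at this
    omega
  obtain ⟨μ, ν, rfl⟩ := exists_eq_X_add_C_of_natDegree_le_one hG1
  exact ⟨μ, ν, by rw [hG, mul_comm]⟩

lemma coeff_natDegree_add_one_foliationOp (d : Derivation ℤ k k) (M A B : k[X]) {F : k[X][X]} :
    (foliationOp d M A B F).coeff (F.natDegree + 1) =
      M * derivative F.leadingCoeff + A * (F.natDegree * F.leadingCoeff) := by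
  rw [foliationOp, coeff_add, coeff_C_mul, coeff_add, coeff_X_mul, coeff_coeffDerivation,
    coeff_coeffDerivation, coeff_eq_zero_of_natDegree_lt (n := F.natDegree + 1) (by omega),
    map_zero, zero_add, derivativeInt_apply, leadingCoeff, add_mul, coeff_add, mul_assoc,
    coeff_C_mul, coeff_C_mul]
  rcases hN : F.natDegree with _ | n
  · obtain ⟨c, rfl⟩ : ∃ c, F = C c := ⟨_, eq_C_of_natDegree_eq_zero hN⟩
    simp
  · rw [show n + 1 + 1 = n + 2 from rfl, coeff_X_pow_mul, coeff_derivative, coeff_derivative,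
        coeff_eq_zero_of_natDegree_lt (n := n + 2 + 1) (by omega)]
    push_cast
    ring

lemma coeff_natDegree_add_one_cofactor_mul (μ ν : k[X]) (F : k[X][X]) :
    ((C μ * X + C ν) * F).coeff (F.natDegree + 1) = μ * F.leadingCoeff := by
  rw [add_mul, coeff_add, mul_assoc, coeff_C_mul, coeff_C_mul, coeff_X_mul,
    coeff_eq_zero_of_natDegree_lt (n := F.natDegree + 1) (by omega), leadingCoeff]
  ring

lemma map_eval_foliationOp {d : Derivation ℤ k k} {M A B μ ν : k[X]} {F : k[X][X]}
    (h : foliationOp d M A B F = (C μ * X + C ν) * F) {e : k} (he : M.eval e = 0) :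
    (C (A.eval e) * X ^ 2 + C (B.eval e)) * derivative (F.map (evalRingHom e)) =
      (C (μ.eval e) * X + C (ν.eval e)) * F.map (evalRingHom e) := by
  have := congrArg (Polynomial.map (evalRingHom e)) h
  simpa [foliationOp, he, derivative_map] using this

lemma map_evalRingHom_ne_zero {F : k[X][X]} (hF : F.IsPrimitive) (e : k) :
    F.map (evalRingHom e) ≠ 0 := by
  intro h0
  have hd : C (X - C e) ∣ F := by
    rw [C_dvd_iff_dvd_coeff]
    intro i
    rw [dvd_iff_isRoot, IsRoot]
    simpa using congrArg (fun p => p.coeff i) h0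
  exact not_isUnit_X_sub_C e (hF _ hd)

lemma eval_one_coeffDerivation (d : Derivation ℤ k k) (p : k[X]) :
    (coeffDerivation d p).eval 1 = d (p.eval 1) := by
  induction p using Polynomial.induction_on' with
  | add p q hp hq => simp only [map_add, eval_add, hp, hq]
  | monomial n a =>
    rw [← C_mul_X_pow_eq_monomial]
    simp [Derivation.leibniz, Derivation.leibniz_pow]

variable [CharZero k]

lemma isUnit_leadingCoeff {d : Derivation ℤ k k} {B : k[X]} {F : k[X][X]} (hF : F.IsPrimitive)
    (h : F ∣ foliationOp d (X * (X - 1)) (C (3 / 2) * X - C (1 / 2)) B F) :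
    IsUnit F.leadingCoeff := by
  have hF0 : F ≠ 0 := hF.ne_zero
  obtain ⟨μ, ν, hq⟩ := exists_cofactor hF0 h
  have hlc := coeff_natDegree_add_one_foliationOp d (X * (X - 1)) (C (3 / 2) * X - C (1 / 2)) B
    (F := F)
  rw [hq, coeff_natDegree_add_one_cofactor_mul] at hlc
  set b := F.leadingCoeff with hb
  have hb0 : b ≠ 0 := leadingCoeff_ne_zero.2 hF0
  obtain ⟨u, i, j, hu, hbu⟩ := exists_eq_pow_mul_pow_of_dvd 0 1 hb0
    ⟨μ - (C (3 / 2) * X - C (1 / 2)) * (F.natDegree : k[X]), by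
      simp only [map_zero, map_one, sub_zero]
      linear_combination -hlc⟩
  simp only [map_zero, map_one, sub_zero] at hbu
  have key := derivation_pow_mul_pow (derivativeInt k) X (X - 1) i j
  simp only [derivativeInt_apply, derivative_sub, derivative_X, derivative_one, sub_zero,
    mul_one] at key
  have hμ : μ = ((i : k[X]) * (X - 1) + (j : k[X]) * X) +
      (C (3 / 2) * X - C (1 / 2)) * (F.natDegree : k[X]) := by
    refine mul_right_cancel₀ hb0 ?_
    rw [hlc, hbu, derivative_C_mul]
    linear_combination C u * key
  have h0 := natDegree_eq_of_mul_derivative (map_evalRingHom_ne_zero hF 0)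
    (map_eval_foliationOp hq (e := 0) (by simp))
  have h1 := natDegree_eq_of_mul_derivative (map_evalRingHom_ne_zero hF 1)
    (map_eval_foliationOp hq (e := 1) (by simp))
  have d0 : (F.map (evalRingHom 0)).natDegree ≤ F.natDegree := natDegree_map_le
  have d1 : (F.map (evalRingHom 1)).natDegree ≤ F.natDegree := natDegree_map_le
  rw [hμ] at h0 h1
  simp at h0 h1
  have hi : i = 0 := by
    have : ((F.map (evalRingHom 0)).natDegree : k) = ((2 * i + F.natDegree : ℕ) : k) := by
      push_cast
      linear_combination -2 * h0
    have := Nat.cast_injective this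
    omega
  have hj : j = 0 := by
    have : ((F.map (evalRingHom 1)).natDegree : k) = ((j + F.natDegree : ℕ) : k) := by
      push_cast
      linear_combination h1
    have := Nat.cast_injective this
    omega
  rw [hbu, hi, hj]
  simpa using hu

/-- The trace of an invariant curve at `Y = 0`. -/
lemma eval_zero_nextCoeff {d : Derivation ℤ k k} {B : k[X]} {F : k[X][X]} (hF : F.Monic)
    (h : F ∣ foliationOp d (X * (X - 1)) (C (3 / 2) * X - C (1 / 2)) B F)
    {s : k} (hB : B.eval 0 = s ^ 2 / 2) :
    ∃ r : ℤ, F.nextCoeff.eval 0 = r * s := by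
  obtain ⟨μ, ν, hq⟩ := exists_cofactor hF.ne_zero h
  have h0 := map_eval_foliationOp hq (e := 0) (by simp)
  obtain ⟨m, n, hmn⟩ := exists_eq_pow_mul_pow_of_monic (hF.map (evalRingHom 0))
    (g := C (-2) * (C (μ.eval 0) * X + C (ν.eval 0))) (by
      rw [mul_assoc, ← h0, hB, ← mul_assoc]
      congr 1
      have e1 : (C (-2) * C (-1 / 2) : k[X]) = 1 := by rw [← C_mul, ← C_1]; congr 1; norm_num
      have e2 : (C (-2) * C (s ^ 2 / 2) : k[X]) = - C (s ^ 2) := by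
        rw [← C_mul, ← C_neg]; congr 1; ring
      simp only [eval_sub, eval_mul, eval_C, eval_X, mul_zero, zero_sub]
      rw [show (-(1 / 2) : k) = -1 / 2 by ring, mul_add, e2, ← mul_assoc, e1]
      ring)
  refine ⟨n - m, ?_⟩
  have hn := nextCoeff_map_eq_of_isUnit_leadingCoeff (evalRingHom (0 : k))
    (hF.leadingCoeff ▸ isUnit_one : IsUnit F.leadingCoeff)
  rw [hmn, nextCoeff_pow_mul_pow] at hn
  exact hn.symm

lemma coeff_natDegree_foliationOp (d : Derivation ℤ k k) (M A B : k[X]) {F : k[X][X]}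
    (hF : F.Monic) {n : ℕ} (hn : F.natDegree = n + 1) :
    (foliationOp d M A B F).coeff (n + 1) =
      M * derivative (F.coeff n) + A * (n * F.coeff n) := by
  have h1 : F.coeff (n + 1) = 1 := by rw [← hn]; exact hF
  have h2 : (X * derivative F).coeff n = n * F.coeff n := by
    rcases n with _ | n
    · simp
    · rw [coeff_X_mul, coeff_derivative]
      push_cast
      ring
  rw [foliationOp, coeff_add, coeff_C_mul, coeff_add, coeff_X_mul, coeff_coeffDerivation,
    coeff_coeffDerivation, h1, derivativeInt_apply, add_mul, coeff_add,
    mul_assoc, coeff_C_mul, coeff_C_mul, pow_two, mul_assoc, coeff_X_mul, h2, coeff_derivative,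
    coeff_eq_zero_of_natDegree_lt (n := n + 1 + 1) (by omega), ← C_1]
  simp

lemma eval_of_mul_derivative {c u v : k} {w : k[X]} (hw : w ≠ 0)
    (h : (X ^ 2 - C (c ^ 2)) * derivative w = (C u * X + C v) * w) :
    ∃ i : ℕ, u * c + v = 2 * i * c := by
  obtain ⟨a, i, j, ha, hwa⟩ := exists_eq_pow_mul_pow_of_dvd c (-c) hw
    ⟨C u * X + C v, by
      rw [mul_comm w, ← h]
      simp only [map_neg, C_pow]
      ring⟩
  have key := derivation_pow_mul_pow (derivativeInt k) (X - C c) (X - C (-c)) i j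
  simp only [derivativeInt_apply, derivative_sub, derivative_X, derivative_C, sub_zero,
    mul_one] at key
  have h1 : (i : k[X]) * (X - C (-c)) + (j : k[X]) * (X - C c) = C u * X + C v := by
    refine mul_right_cancel₀ hw ?_
    rw [← h, hwa, derivative_C_mul, C_pow]
    rw [C_neg] at key ⊢
    linear_combination -C a * key
  refine ⟨i, ?_⟩
  have := congrArg (eval c) h1
  simp at this
  linear_combination -this

/-- The first order expansion of an invariant curve at `Y = 1`. -/
lemma eval_one_nextCoeff {d : Derivation ℤ k k} {B : k[X]} {F : k[X][X]} (hF : F.Monic)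
    (h : F ∣ foliationOp d (X * (X - 1)) (C (3 / 2) * X - C (1 / 2)) B F)
    {c g₀ : k} (hc : c ≠ 0) (hdc : d c = c) (hB : B.eval 1 = - c ^ 2)
    (hB' : (derivative B).eval 1 = g₀ - 5 / 2 * c ^ 2) :
    ∃ r : ℤ, c ^ 2 * ((derivative F.nextCoeff).eval 1 - F.nextCoeff.eval 1) =
      - F.natDegree * c ^ 2 + r * g₀ * c := by
  rcases hN : F.natDegree with _ | N
  · exact ⟨0, by simp [nextCoeff, hN]⟩
  obtain ⟨μ, ν, hq⟩ := exists_cofactor hF.ne_zero h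
  have hnext : F.nextCoeff = F.coeff N := by simp [nextCoeff, hN]
  have hμ := coeff_natDegree_add_one_foliationOp d (X * (X - 1)) (C (3 / 2) * X - C (1 / 2)) B
    (F := F)
  rw [hq, coeff_natDegree_add_one_cofactor_mul, hF.leadingCoeff, hN] at hμ
  have hν := coeff_natDegree_foliationOp d (X * (X - 1)) (C (3 / 2) * X - C (1 / 2)) B hF hN
  have hFN : F.coeff (N + 1) = 1 := by rw [← hN]; exact hF
  rw [hq, add_mul, coeff_add, mul_assoc, coeff_C_mul, coeff_C_mul, coeff_X_mul, hFN,
    ← hnext] at hν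
  set a := F.nextCoeff
  have hμ' : μ = (C (3 / 2) * X - C (1 / 2)) * ((N + 1 : ℕ) : k[X]) := by
    simpa using hμ
  have hν' : ν = X * (X - 1) * derivative a - (C (3 / 2) * X - C (1 / 2)) * a := by
    rw [hμ'] at hν
    push_cast at hν
    linear_combination hν
  set f := F.map (evalRingHom 1) with hf
  have hfm : f.Monic := hF.map _
  have h0 := map_eval_foliationOp hq (e := 1) (by simp)
  rw [← hf, hB, hμ', hν'] at h0
  have h0' : (X ^ 2 - C (c ^ 2)) * derivative f =
      (C ((N + 1 : ℕ) : k) * X + C (- a.eval 1)) * f := by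
    have h3 : (C (3 / 2) : k[X]) - C (1 / 2) = 1 := by
      rw [← C_sub, ← C_1]; congr 1; norm_num
    have h3' : (3 / 2 - 1 / 2 : k) = 1 := by norm_num
    simp only [eval_sub, eval_mul, eval_C, eval_X, eval_one, eval_natCast, sub_self, mul_zero,
      zero_mul, mul_one, zero_sub, h3', one_mul, C_1, C_neg] at h0
    rw [C_neg]
    linear_combination h0
  obtain ⟨m, n, hmn⟩ := exists_eq_pow_mul_pow_of_monic hfm h0'
  have hmnN : m + n = N + 1 := by
    rw [← natDegree_pow_mul_pow c, ← hmn, hf, hF.natDegree_map, hN]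
  have ha : a.eval 1 = ((n : ℤ) - m : ℤ) * c := by
    rw [← nextCoeff_pow_mul_pow, ← hmn, hf, nextCoeff_map_eq_of_isUnit_leadingCoeff
      (evalRingHom (1 : k)) (hF.leadingCoeff ▸ isUnit_one : IsUnit F.leadingCoeff)]
    rfl
  set g := (coeffDerivation (derivativeInt k) F).map (evalRingHom 1) with hg
  have h1 : coeffDerivation d f + X * g + (C (3 / 2) * X ^ 2 + C (g₀ - 5 / 2 * c ^ 2)) *
      derivative f + (X ^ 2 - C (c ^ 2)) * derivative g =
      (C (3 / 2 * ((N + 1 : ℕ) : k)) * X + C (-(3 / 2) * a.eval 1)) * f +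
        (C ((N + 1 : ℕ) : k) * X + C (- a.eval 1)) * g := by
    have hd : ((coeffDerivation (coeffDerivation d) F).map (evalRingHom 1)) =
        coeffDerivation d f := by
      refine map_coeffDerivation _ _ _ (fun p => ?_) _
      exact eval_one_coeffDerivation d p
    have h2 := congrArg (fun p => (coeffDerivation (derivativeInt k) p).map (evalRingHom 1)) hq
    rw [foliationOp] at h2
    simp only [map_add, Derivation.leibniz, Derivation.leibniz_pow, coeffDerivation_C,
      coeffDerivation_X, coeffDerivation_comm, smul_eq_mul, derivativeInt_apply,
      Polynomial.map_add, Polynomial.map_mul, Polynomial.map_pow, map_C, map_X, smul_zero,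
      mul_zero, add_zero, zero_add, ← derivative_map, ← hf, ← hg, hd, coe_evalRingHom] at h2
    have e1 : eval 1 (X * (X - 1) : k[X]) = 0 := by simp
    have e2 : eval 1 (X * derivative (X - 1) : k[X]) = 1 := by simp
    have e3 : eval 1 ((X - 1) * derivative X : k[X]) = 0 := by simp
    have e4 : eval 1 (C (3 / 2) * X - C (1 / 2) : k[X]) = 1 := by simp; norm_num
    have e5 : eval 1 (derivative (C (3 / 2) * X - C (1 / 2)) : k[X]) = 3 / 2 := by simp
    have e6 : eval 1 μ = ((N + 1 : ℕ) : k) := by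
      rw [hμ', eval_mul, e4, one_mul, eval_natCast]
    have e7 : eval 1 ν = - a.eval 1 := by
      rw [hν', eval_sub, eval_mul, e1, eval_mul, e4]; ring
    have e8 : eval 1 (derivative μ) = 3 / 2 * ((N + 1 : ℕ) : k) := by
      rw [hμ', derivative_mul, derivative_natCast, mul_zero, add_zero, eval_mul, e5, eval_natCast]
    have e9 : eval 1 (derivative ν) = -(3 / 2) * a.eval 1 := by
      rw [hν']
      simp
      ring
    rw [e1, e2, e3, e4, e5, e6, e7, e8, e9, hB, hB'] at h2
    rw [C_0, C_1] at h2
    rw [C_neg] at h2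
    linear_combination h2
  have hf' := derivation_pow_mul_pow (derivativeInt k) (X - C c) (X + C c) m n
  have hfd := derivation_pow_mul_pow (coeffDerivation d) (X - C c) (X + C c) m n
  rw [← hmn] at hf' hfd
  simp only [derivativeInt_apply, map_sub, map_add, derivative_X, derivative_C, coeffDerivation_X,
    coeffDerivation_C, hdc, sub_zero, add_zero, mul_one, zero_sub, zero_add] at hf' hfd
  obtain ⟨e, he⟩ : ∃ e, e * c = g₀ - c ^ 2 := ⟨(g₀ - c ^ 2) / c, div_mul_cancel₀ _ hc⟩
  have hN1 : ((N + 1 : ℕ) : k) = m + n := by rw [← hmnN]; push_cast; ring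
  have ha' : -a.eval 1 = ((m : k) - n) * c := by rw [ha]; push_cast; ring
  set ρ : k := -(m + n) + (m - n) * e with hρ
  set σ : k := (m + n) * (g₀ - c ^ 2) - (m - n) * c with hσ
  have hg₀ : g₀ = e * c + c ^ 2 := by rw [he]; ring
  set w := (X ^ 2 - C (c ^ 2)) * g - (C ρ * X + C σ) * f with hw
  have hw' : (X ^ 2 - C (c ^ 2)) * derivative w =
      (C ((m : k) + n + 1) * X + C (((m : k) - n) * c)) * w := by
    rw [hN1, show -(3 / 2) * a.eval 1 = 3 / 2 * (((m : k) - n) * c) by rw [← ha']; ring, ha', hg₀]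
      at h1
    have h52 : (C (5 / 2) : k[X]) = C (3 / 2) + 1 := by
      rw [← C_1, ← C_add]
      congr 1; norm_num
    have dw : derivative w = 2 * X * g + (X ^ 2 - C (c ^ 2)) * derivative g - C ρ * f -
        (C ρ * X + C σ) * derivative f := by
      rw [hw]
      simp only [derivative_sub, derivative_mul, derivative_add, derivative_X, derivative_C,
        derivative_X_pow, show (C ((2 : ℕ) : k)) = 2 from rfl]
      ring
    rw [dw, hw, hρ, hσ, hg₀]
    simp only [C_add, C_sub, C_mul, C_neg, map_natCast, C_1, map_pow, h52] at h1 hf' hfd ⊢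
    linear_combination (X ^ 2 - C c ^ 2) * h1 - hfd -
      (C (3 / 2) * X ^ 2 + C e * C c + C c ^ 2 - (C (3 / 2) + 1) * C c ^ 2) * hf' -
      ((-(m + n) + (m - n) * C e) * X + ((m + n) * (C e * C c + C c ^ 2 - C c ^ 2) - (m - n) * C c))
        * hf'
  have hw0 : w = 0 := by
    by_contra hne
    obtain ⟨i, hi⟩ := eval_of_mul_derivative hne hw'
    have h3 : ((2 * m + 1 : ℕ) : k) = ((2 * i : ℕ) : k) := by
      refine mul_right_cancel₀ hc ?_
      push_cast
      linear_combination hi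
    have := Nat.cast_injective h3
    omega
  refine ⟨m - n, ?_⟩
  have hgN : g.coeff N = (derivative a).eval 1 := by
    rw [hg, coeff_map, coeff_coeffDerivation, derivativeInt_apply, ← hnext]
    rfl
  have hgN2 : g.coeff (N + 2) = 0 := by
    rw [hg, coeff_map, coeff_coeffDerivation, coeff_eq_zero_of_natDegree_lt (by omega)]
    simp
  have h4 := congrArg (fun p => p.coeff (N + 2)) (sub_eq_zero.1 hw0)
  have hf1 : f.coeff (N + 1) = 1 := by
    rw [hf, coeff_map, hFN]; simp
  have hf2 : f.coeff (N + 2) = 0 := by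
    rw [hf, coeff_map, coeff_eq_zero_of_natDegree_lt (by omega)]; simp
  simp only [sub_mul, add_mul, coeff_sub, coeff_add, mul_assoc, coeff_C_mul, coeff_X_pow_mul,
    coeff_X_mul, hgN, hgN2, hf1, hf2] at h4
  rw [hN1, show a.eval 1 = -(((m : k) - n) * c) by rw [← ha']; ring]
  rw [hρ] at h4
  push_cast
  linear_combination c ^ 2 * h4 + (m - n) * c * he

end Operator

section Evaluation

variable {k L : Type*} [Field k] [Field L] [Algebra k L]

lemma derivation_aeval {θ : Derivation ℤ L L} {d : Derivation ℤ k k}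
    (hd : ∀ a, algebraMap k L (d a) = θ (algebraMap k L a)) (y : L) (p : k[X]) :
    θ (aeval y p) = aeval y (coeffDerivation d p) + aeval y (derivative p) * θ y := by
  induction p using Polynomial.induction_on' with
  | add p q hp hq =>
    simp only [map_add, hp, hq]
    ring
  | monomial n a =>
    rw [← C_mul_X_pow_eq_monomial]
    rcases n with _ | n
    · simp [hd]
    · simp [hd, Derivation.leibniz, Derivation.leibniz_pow]
      ring

lemma aevalAeval_foliationOp {θ : Derivation ℤ L L} {d : Derivation ℤ k k}
    (hd : ∀ a, algebraMap k L (d a) = θ (algebraMap k L a)) {y z : L} (hy : θ y = z)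
    {M A B : k[X]} (hz : aeval y M * θ z = aeval y A * z ^ 2 + aeval y B) (G : k[X][X]) :
    aevalAeval y z (foliationOp d M A B G) = aeval y M * θ (aevalAeval y z G) := by
  induction G using Polynomial.induction_on' with
  | add p q hp hq =>
    have : foliationOp d M A B (p + q) = foliationOp d M A B p + foliationOp d M A B q := by
      simp only [foliationOp, map_add]
      ring
    rw [this, map_add, hp, hq, map_add, map_add]
    ring
  | monomial n a =>
    rw [← C_mul_X_pow_eq_monomial]
    have h1 := derivation_aeval hd y a
    rcases n with _ | n
    · simp [foliationOp, h1, hy]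
    · simp [foliationOp, Derivation.leibniz, Derivation.leibniz_pow, h1, hy]
      linear_combination -(n + 1) * z ^ n * aeval y a * hz

/-- If `y` is transcendental but `y, z` are algebraically dependent, the relations between `y` and
`z` are the multiples of a single primitive polynomial. -/
lemma exists_isPrimitive_generator {y z : L} (hy : Transcendental k y) {G : k[X][X]}
    (hG : G ≠ 0) (hG0 : aevalAeval y z G = 0) :
    ∃ F : k[X][X], F.IsPrimitive ∧ F.natDegree ≠ 0 ∧ aevalAeval y z F = 0 ∧
      ∀ H : k[X][X], aevalAeval y z H = 0 → F ∣ H := by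
  obtain ⟨F, hFmem, hF⟩ := Ideal.IsPrime.exists_mem_prime_of_ne_bot
    (RingHom.ker_isPrime (aevalAeval y z : k[X][X] →ₐ[k] L))
    (fun h => hG (by rwa [← Ideal.mem_bot, ← h, RingHom.mem_ker]))
  have hF0 : aevalAeval y z F = 0 := hFmem
  have hdeg : F.natDegree ≠ 0 := by
    intro h
    obtain ⟨c, rfl⟩ : ∃ c, F = C c := ⟨_, eq_C_of_natDegree_eq_zero h⟩
    rw [aevalAeval_C] at hF0
    exact hF.ne_zero (by rw [transcendental_iff.1 hy c hF0, C_0])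
  have hprim := hF.irreducible.isPrimitive hdeg
  refine ⟨F, hprim, hdeg, hF0, fun H hH => ?_⟩
  have hinj : Function.Injective ((aeval y : k[X] →ₐ[k] L) : k[X] →+* L) :=
    transcendental_iff_injective.1 hy
  let : Algebra (RatFunc k) L := (IsFractionRing.lift hinj).toAlgebra
  have hcomp : ∀ P : k[X][X], aeval z (P.map (algebraMap k[X] (RatFunc k))) =
      aevalAeval y z P := by
    intro P
    have h1 : (algebraMap (RatFunc k) L).comp (algebraMap k[X] (RatFunc k)) =
        ((aeval y : k[X] →ₐ[k] L) : k[X] →+* L) := by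
      ext p
      · exact IsFractionRing.lift_algebraMap hinj _
      · exact IsFractionRing.lift_algebraMap hinj _
    rw [aeval_def, eval₂_map, h1]
    induction P using Polynomial.induction_on' with
    | add p q hp hq => rw [eval₂_add, hp, hq, map_add]
    | monomial n a => rw [← C_mul_X_pow_eq_monomial]; simp
  refine hprim.dvd_of_fraction_map_dvd_fraction_map (K := RatFunc k) ?_
  have hirr := hprim.irreducible_iff_irreducible_map_fraction_map (K := RatFunc k) |>.1
    hF.irreducible
  have h2 := minpoly.eq_of_irreducible hirr (x := z) (by rw [hcomp, hF0])
  have h3 := minpoly.dvd (RatFunc k) z (p := H.map (algebraMap k[X] (RatFunc k)))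
    (by rw [hcomp, hH])
  exact (Dvd.intro _ h2).trans h3

end Evaluation

section Reciprocal

variable {k L : Type*} [Field k] [Field L] [Algebra k L]

/-- The polynomial `Y ^ n * G (1 / Y, - Z / Y ^ 2)`, when `n` is large. -/
noncomputable def reciprocal (n : ℕ) (G : k[X][X]) : k[X][X] :=
  G.sum fun j p => monomial j ((-1) ^ j * reflect (n - 2 * j) p)

lemma coeff_reciprocal (n : ℕ) (G : k[X][X]) (j : ℕ) :
    (reciprocal n G).coeff j = (-1) ^ j * reflect (n - 2 * j) (G.coeff j) := by
  rw [reciprocal, sum_def, finsetSum_coeff]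
  simp only [coeff_monomial]
  rw [Finset.sum_ite_eq']
  split_ifs with h
  · rfl
  · rw [notMem_support_iff.1 h, reflect_zero, mul_zero]

lemma natDegree_reciprocal_le (n : ℕ) (G : k[X][X]) :
    (reciprocal n G).natDegree ≤ G.natDegree := by
  rw [natDegree_le_iff_coeff_eq_zero]
  intro j hj
  rw [coeff_reciprocal, coeff_eq_zero_of_natDegree_lt hj, reflect_zero, mul_zero]

lemma reciprocal_ne_zero (n : ℕ) {G : k[X][X]} (hG : G ≠ 0) : reciprocal n G ≠ 0 := by
  intro h
  apply leadingCoeff_ne_zero.2 hG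
  have := congrArg (fun p => p.coeff G.natDegree) h
  rw [coeff_reciprocal, coeff_zero] at this
  exact reflect_eq_zero_iff.1 ((mul_eq_zero.1 this).resolve_left (by simp))

lemma exists_forall_natDegree_coeff_le (G : k[X][X]) :
    ∃ n : ℕ, ∀ j ≤ G.natDegree, 2 * j + (G.coeff j).natDegree ≤ n :=
  ⟨2 * G.natDegree + G.support.sup fun j => (G.coeff j).natDegree, fun j hj => by
    by_cases h : j ∈ G.support
    · have := Finset.le_sup (f := fun j => (G.coeff j).natDegree) h
      omega
    · rw [notMem_support_iff.1 h, natDegree_zero]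
      omega⟩

lemma aeval_reflect {y : L} (hy : y ≠ 0) {n : ℕ} {p : k[X]} (hp : p.natDegree ≤ n) :
    aeval y (reflect n p) = y ^ n * aeval y⁻¹ p := by
  let := invertibleOfNonzero (inv_ne_zero hy)
  have := eval₂_reflect_mul_pow (algebraMap k L) y⁻¹ n p hp
  rw [invOf_eq_inv, inv_inv] at this
  rw [aeval_def, aeval_def, ← this, mul_comm, mul_assoc, ← mul_pow, inv_mul_cancel₀ hy, one_pow,
    mul_one]

lemma aevalAeval_eq_sum (y z : L) (G : k[X][X]) :
    aevalAeval y z G = G.sum fun j p => aeval y p * z ^ j := by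
  conv_lhs => rw [G.as_sum_support]
  rw [map_sum, sum_def]
  refine Finset.sum_congr rfl fun j _ => ?_
  rw [← C_mul_X_pow_eq_monomial, map_mul, map_pow, aevalAeval_C, aevalAeval_Y]

lemma aevalAeval_reciprocal {y : L} (hy : y ≠ 0) (z : L) {n : ℕ} {G : k[X][X]}
    (hn : ∀ j ≤ G.natDegree, 2 * j + (G.coeff j).natDegree ≤ n) :
    aevalAeval y z (reciprocal n G) = y ^ n * aevalAeval y⁻¹ (-z / y ^ 2) G := by
  rw [aevalAeval_eq_sum _ _ G, reciprocal, sum_def, sum_def, map_sum, Finset.mul_sum]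
  refine Finset.sum_congr rfl fun j hj => ?_
  have hj' := hn j (le_natDegree_of_mem_supp j hj)
  rw [← C_mul_X_pow_eq_monomial, map_mul, map_pow, aevalAeval_C, aevalAeval_Y, map_mul,
    aeval_reflect hy (by omega), map_pow, map_neg, map_one, div_pow, neg_pow z, ← pow_mul]
  have : y ^ n = y ^ (n - 2 * j) * y ^ (2 * j) := by rw [← pow_add]; congr 1; omega
  rw [this]
  field_simp

lemma exists_reciprocal_relation {y z : L} (hy : y ≠ 0) {G : k[X][X]} (hG : G ≠ 0)
    (hG0 : aevalAeval y⁻¹ (-z / y ^ 2) G = 0) :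
    ∃ H : k[X][X], H ≠ 0 ∧ H.natDegree ≤ G.natDegree ∧ aevalAeval y z H = 0 := by
  obtain ⟨n, hn⟩ := exists_forall_natDegree_coeff_le G
  exact ⟨reciprocal n G, reciprocal_ne_zero n hG, natDegree_reciprocal_le n G,
    by rw [aevalAeval_reciprocal hy z hn, hG0, mul_zero]⟩

/-- The behaviour at infinity of an invariant curve, in terms of its reciprocal. -/
lemma nextCoeff_eq_of_reciprocal {y z : L} (hy : y ≠ 0) {F F' : k[X][X]}
    (hF : F.Monic) (hF' : F'.Monic) (hF0 : aevalAeval y z F = 0)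
    (hF0' : aevalAeval y⁻¹ (-z / y ^ 2) F' = 0)
    (hgen : ∀ H : k[X][X], aevalAeval y z H = 0 → F ∣ H)
    (hgen' : ∀ H : k[X][X], aevalAeval y⁻¹ (-z / y ^ 2) H = 0 → F' ∣ H) :
    (derivative F.nextCoeff).eval 1 - F.nextCoeff.eval 1 =
      - F'.nextCoeff.eval 0 - F.nextCoeff.eval 0 := by
  have hle : F'.natDegree ≤ F.natDegree := by
    obtain ⟨H, hH, hdeg, hH0⟩ := exists_reciprocal_relation (z := -z / y ^ 2) (inv_ne_zero hy)
      hF.ne_zero (by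
        rw [inv_inv, show -(-z / y ^ 2) / y⁻¹ ^ 2 = z by field_simp, hF0])
    exact (natDegree_le_of_dvd (hgen' H hH0) hH).trans hdeg
  obtain ⟨n, hn⟩ := exists_forall_natDegree_coeff_le F'
  have hH := natDegree_reciprocal_le n F'
  obtain ⟨Q, hQ⟩ := hgen (reciprocal n F') (by
    rw [aevalAeval_reciprocal hy z hn, hF0', mul_zero])
  have hQ0 : Q ≠ 0 := by
    rintro rfl
    exact reciprocal_ne_zero n hF'.ne_zero (by rw [hQ, mul_zero])
  rw [hQ, natDegree_mul hF.ne_zero hQ0] at hH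
  have hdeg : F'.natDegree = F.natDegree := by omega
  obtain ⟨q, rfl⟩ : ∃ q, Q = C q := ⟨_, eq_C_of_natDegree_eq_zero (by omega)⟩
  rcases hN : F.natDegree with _ | N
  · simp [nextCoeff, hN, hdeg]
  have e1 : F.nextCoeff = F.coeff N := by simp [nextCoeff, hN]
  have e2 : F'.nextCoeff = F'.coeff N := by simp [nextCoeff, hN, hdeg]
  have hn1 := hn (N + 1) (by omega)
  have hn2 := hn N (by omega)
  obtain ⟨m, rfl⟩ : ∃ m, n = m + 2 * (N + 1) := ⟨n - 2 * (N + 1), by omega⟩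
  have h1 := congrArg (fun p => p.coeff (N + 1)) hQ
  have h2 := congrArg (fun p => p.coeff N) hQ
  have hFN : F.coeff (N + 1) = 1 := by rw [← hN]; exact hF
  have hFN' : F'.coeff (N + 1) = 1 := by rw [← hN, ← hdeg]; exact hF'
  simp only [coeff_reciprocal, coeff_mul_C, hFN, hFN', one_mul, Nat.add_sub_cancel,
    reflect_one] at h1 h2
  rw [← e1, ← e2, ← h1, show m + 2 * (N + 1) - 2 * N = m + 2 by omega] at h2
  have h3 : reflect (m + 2) F'.nextCoeff = - (F.nextCoeff * X ^ m) := by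
    refine mul_left_cancel₀ (pow_ne_zero N (by simp : (-1 : k[X]) ≠ 0)) ?_
    rw [h2]
    ring
  have h4 : ∀ i, F.nextCoeff.coeff i = - F'.nextCoeff.coeff (revAt (m + 2) (i + m)) := by
    intro i
    have := congrArg (fun p => p.coeff (i + m)) h3
    simp only [coeff_reflect, coeff_neg, coeff_mul_X_pow] at this
    rw [this, neg_neg]
  have h5 : F.nextCoeff.coeff 2 = - F'.nextCoeff.coeff 0 := by
    rw [h4, revAt_le (by omega)]
    congr 2
    omega
  have h6 : F.nextCoeff.natDegree ≤ 2 := by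
    rw [natDegree_le_iff_coeff_eq_zero]
    intro i hi
    rw [h4, revAt_eq_self_of_lt (by omega), coeff_eq_zero_of_natDegree_lt (by rw [e2]; omega),
      neg_zero]
  rw [← coeff_zero_eq_eval_zero, ← coeff_zero_eq_eval_zero, ← h5]
  have h7 := F.nextCoeff.as_sum_range_C_mul_X_pow' (n := 3) (by omega)
  set a := F.nextCoeff
  have h8 : a.eval 1 = a.coeff 0 + a.coeff 1 + a.coeff 2 := by
    conv_lhs => rw [h7]
    simp [Finset.sum_range_succ]
  have h9 : (derivative a).eval 1 = a.coeff 1 + a.coeff 2 * 2 := by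
    conv_lhs => rw [h7]
    simp [Finset.sum_range_succ, one_add_one_eq_two]
  rw [h8, h9]
  ring

end Reciprocal

lemma natCast_mul_ne_of_algebraicIndependent {α β γ δ : ℂ}
    (hind : AlgebraicIndependent ℚ ![α, β, γ, δ]) {s₀ s κ : ℂ} (hs₀ : s₀ ^ 2 = -2 * β)
    (hs : s ^ 2 = 2 * α) (hκ : κ ^ 2 = -2 * δ) {N : ℕ} (hN : N ≠ 0) (p q r : ℤ) :
    N * κ ≠ (p * s₀ + q * s) * κ + r * γ := by
  intro h
  let u : MvPolynomial (Fin 4) ℚ := -2 * p ^ 2 * .X 1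
  let v : MvPolynomial (Fin 4) ℚ := 2 * q ^ 2 * .X 0
  let w : MvPolynomial (Fin 4) ℚ := -.C (1 / 2) * r ^ 2 * .X 2 ^ 2
  let S : MvPolynomial (Fin 4) ℚ := .X 3 * (N ^ 2 + u - v) - w
  let P : MvPolynomial (Fin 4) ℚ := (S ^ 2 + 4 * N ^ 2 * u * .X 3 ^ 2 - 4 * v * w * .X 3) ^ 2 -
    16 * N ^ 2 * S ^ 2 * u * .X 3 ^ 2
  have hP : P = 0 := by
    refine (injective_iff_map_eq_zero (MvPolynomial.aeval (R := ℚ) ![α, β, γ, δ])).1 hind P ?_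
    simp only [P, S, u, v, w, map_sub, map_mul, map_add, map_pow, MvPolynomial.aeval_X, map_neg,
      map_natCast, map_intCast, map_ofNat, MvPolynomial.aeval_C, map_div₀, map_one]
    simp only [Matrix.cons_val]
    have hw : δ * (N - p * s₀ - q * s) ^ 2 = -(1 / 2) * r ^ 2 * γ ^ 2 := by
      have h1 : (N - p * s₀ - q * s) * κ = r * γ := by linear_combination h
      have h2 := congrArg (fun x => x ^ 2) h1
      simp only [mul_pow, hκ] at h2
      linear_combination -(1 / 2) * h2
    have hα : α = s ^ 2 / 2 := by rw [hs]; ring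
    have hβ : β = -s₀ ^ 2 / 2 := by rw [hs₀]; ring
    rw [← hw, hα, hβ]
    ring
  have h1 := congrArg (MvPolynomial.eval (![0, 0, 0, 1] : Fin 4 → ℚ)) hP
  simp [P, S, u, v, w] at h1
  exact hN h1

section PainleveV

/-- The polynomial `B` for which `P_V` reads `y (y - 1) ϑ² y = (3 y - 1) / 2 * (ϑ y) ^ 2 + B(y)`
with `ϑ = t d/dt`, where `a = α`, `b = β`, `g = γ t` and `e = δ t ^ 2`. -/
noncomputable def painleveVPoly {k : Type*} [Field k] (a b g e : k) : k[X] :=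
  (X - 1) ^ 3 * (C a * X ^ 2 + C b) + C g * X ^ 2 * (X - 1) + C e * X ^ 2 * (X + 1)

variable {k L : Type*} [Field k] [CharZero k] [Field L] [Algebra k L]
  {θ : Derivation ℤ L L} {d : Derivation ℤ k k}

lemma exists_monic_generator (hd : ∀ a, algebraMap k L (d a) = θ (algebraMap k L a)) {y z : L}
    (hθ : θ y = z) {B : k[X]}
    (hz : y * (y - 1) * θ z = (3 * y - 1) / 2 * z ^ 2 + aeval y B) (hy : Transcendental k y)
    {G : k[X][X]} (hG : G ≠ 0) (hG0 : aevalAeval y z G = 0) :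
    ∃ F : k[X][X], F.Monic ∧ F.natDegree ≠ 0 ∧ aevalAeval y z F = 0 ∧
      (∀ H : k[X][X], aevalAeval y z H = 0 → F ∣ H) ∧
      F ∣ foliationOp d (X * (X - 1)) (C (3 / 2) * X - C (1 / 2)) B F := by
  have hz' : aeval y (X * (X - 1) : k[X]) * θ z =
      aeval y (C (3 / 2) * X - C (1 / 2) : k[X]) * z ^ 2 + aeval y B := by
    simp only [map_mul, map_sub, aeval_X, map_one, aeval_C, map_div₀, map_ofNat]
    linear_combination hz
  have hop : ∀ F : k[X][X], aevalAeval y z F = 0 → aevalAeval y z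
      (foliationOp d (X * (X - 1)) (C (3 / 2) * X - C (1 / 2)) B F) = 0 := by
    intro F hF
    rw [aevalAeval_foliationOp hd hθ hz', hF, map_zero, mul_zero]
  obtain ⟨F, hprim, hdeg, hF0, hgen⟩ := exists_isPrimitive_generator hy hG hG0
  obtain ⟨u, hu⟩ := isUnit_leadingCoeff hprim (hgen _ (hop F hF0))
  have hu1 : (↑u⁻¹ : k[X]) * F.leadingCoeff = 1 := by rw [← hu, Units.inv_mul]
  have hF1 : aevalAeval y z (C (↑u⁻¹ : k[X]) * F) = 0 := by rw [map_mul, hF0, mul_zero]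
  have hgen1 : ∀ H : k[X][X], aevalAeval y z H = 0 → C (↑u⁻¹ : k[X]) * F ∣ H := by
    intro H hH
    exact ((u⁻¹).isUnit.map C).mul_left_dvd.2 (hgen H hH)
  refine ⟨C (↑u⁻¹ : k[X]) * F, monic_C_mul_of_mul_leadingCoeff_eq_one hu1, ?_, hF1, hgen1,
    hgen1 _ (hop _ hF1)⟩
  rwa [natDegree_C_mul (Units.ne_zero _)]

/-- An algebraic relation between `y` and `ϑ y` for a transcendental solution `y` of `P_V` forces a
`ℤ`-linear relation between the exponents at `0`, `∞` and `1`. -/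
lemma exists_int_relation (hd : ∀ a, algebraMap k L (d a) = θ (algebraMap k L a)) {y z : L}
    (hθ : θ y = z) {s₀ s c g : k} (hc : c ≠ 0) (hdc : d c = c)
    (hz : y * (y - 1) * θ z = (3 * y - 1) / 2 * z ^ 2 +
      aeval y (painleveVPoly (s ^ 2 / 2) (-s₀ ^ 2 / 2) g (-c ^ 2 / 2)))
    (hy : Transcendental k y) {G : k[X][X]} (hG : G ≠ 0) (hG0 : aevalAeval y z G = 0) :
    ∃ (N : ℕ) (p q r : ℤ), N ≠ 0 ∧ N * c = (p * s₀ + q * s) * c + r * g := by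
  have hy0 : y ≠ 0 := by
    rintro rfl
    exact hy isAlgebraic_zero
  have hL : CharZero L := charZero_of_injective_algebraMap (algebraMap k L).injective
  obtain ⟨F, hF, hdeg, hF0, hgen, hop⟩ := exists_monic_generator hd hθ hz hy hG hG0
  have hθ' : θ y⁻¹ = -z / y ^ 2 := by
    rw [Derivation.leibniz_inv, hθ, smul_eq_mul]
    field_simp
  have hz' : y⁻¹ * (y⁻¹ - 1) * θ (-z / y ^ 2) = (3 * y⁻¹ - 1) / 2 * (-z / y ^ 2) ^ 2 +
      aeval y⁻¹ (painleveVPoly (s₀ ^ 2 / 2) (-s ^ 2 / 2) (-g) (-c ^ 2 / 2)) := by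
    have h1 : θ (-z / y ^ 2) = -θ z / y ^ 2 + 2 * z ^ 2 / y ^ 3 := by
      rw [div_eq_mul_inv, ← inv_pow, Derivation.leibniz, Derivation.leibniz_pow,
        Derivation.leibniz_inv, hθ]
      simp only [smul_eq_mul, nsmul_eq_mul, map_neg]
      push_cast
      field_simp
      ring
    rw [h1]
    simp only [painleveVPoly, map_add, map_mul, map_sub, map_pow, aeval_X, aeval_C, map_one]
      at hz ⊢
    simp only [map_div₀, map_neg, map_pow, map_ofNat] at hz ⊢
    field_simp at hz ⊢
    linear_combination hz
  obtain ⟨G', hG', -, hG0'⟩ := exists_reciprocal_relation (z := -z / y ^ 2) (inv_ne_zero hy0) hG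
    (by rw [inv_inv, show -(-z / y ^ 2) / y⁻¹ ^ 2 = z by field_simp, hG0])
  obtain ⟨F', hF', -, hF0', hgen', hop'⟩ := exists_monic_generator hd hθ' hz'
    (fun h => hy (by simpa using h.inv)) hG' hG0'
  obtain ⟨p, hp⟩ := eval_zero_nextCoeff hF hop (s := s₀) (by simp [painleveVPoly]; ring)
  obtain ⟨q, hq⟩ := eval_zero_nextCoeff hF' hop' (s := s) (by simp [painleveVPoly]; ring)
  obtain ⟨r, hr⟩ := eval_one_nextCoeff hF hop (g₀ := g) hc hdc
    (by simp [painleveVPoly]; ring) (by simp [painleveVPoly, derivative_pow]; ring)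
  rw [nextCoeff_eq_of_reciprocal hy0 hF hF' hF0 hF0' hgen hgen', hp, hq] at hr
  refine ⟨F.natDegree, p, q, r, hdeg, mul_right_cancel₀ hc ?_⟩
  linear_combination hr

end PainleveV

lemma exists_aevalAeval_eq_zero_of_not_algebraicIndependent {k L : Type*} [Field k] [Field L]
    [Algebra k L] {x y : L} (h : ¬ AlgebraicIndependent k ![x, y]) :
    ∃ G : k[X][X], G ≠ 0 ∧ aevalAeval x y G = 0 := by
  rw [algebraicIndependent_iff] at h
  push Not at h
  obtain ⟨P, hP, hP0⟩ := h
  refine ⟨(Bivariate.equivMvPolynomial k).symm P, by simpa using hP0, ?_⟩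
  have : (aevalAeval x y).comp ((Bivariate.equivMvPolynomial k).symm : _ →ₐ[k] k[X][X]) =
      MvPolynomial.aeval ![x, y] := by
    ext i
    fin_cases i <;> simp
  rw [← hP, ← this]
  rfl

lemma exists_aevalAeval_mul_eq_zero {k L : Type*} [Field k] [Field L] [Algebra k L] {x y : L}
    {a : k} (ha : a ≠ 0) {G : k[X][X]} (hG : G ≠ 0) (h : aevalAeval x y G = 0) :
    ∃ H : k[X][X], H ≠ 0 ∧ aevalAeval x (algebraMap k L a * y) H = 0 := by
  have ha' : algebraMap k L a ≠ 0 := by simpa using ha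
  refine ⟨G.comp (C (C a⁻¹) * X), ?_, ?_⟩
  · rwa [Ne, comp_C_mul_X_eq_zero_iff]
    simp [ha]
  · rw [← h]
    clear h hG
    induction G using Polynomial.induction_on' with
    | add p q hp hq => rw [add_comp, map_add, map_add, hp, hq]
    | monomial n b =>
      rw [← C_mul_X_pow_eq_monomial]
      simp [ha']

end InvariantCurves

/-- Strong minimality part of Proposition 3.15 for generic `P_V`: for `α, β, γ, δ ∈ ℂ`
algebraically independent over `ℚ`, any solution `y` with `y ≠ 0`, `y ≠ 1` of the fifth
Painlevé equation
`y'' = (1/(2y) + 1/(y−1))(y')² − (1/t)y' + ((y−1)²/t²)(αy + β/y) + γy/t + δ·y(y+1)/(y−1)`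
is either algebraic over a differential subfield `K`, or `y, y'` are algebraically
independent over `K`. -/
theorem painleveV_strongly_minimal
    (α β γ δ : ℂ) (hind : AlgebraicIndependent ℚ ![α, β, γ, δ])
    (L : Type*) [Field L] [Algebra ℂ L]
    (D : L → L)
    (hD_add : ∀ a b : L, D (a + b) = D a + D b)
    (hD_mul : ∀ a b : L, D (a * b) = a * D b + b * D a)
    (hD_const : ∀ c : ℂ, D (algebraMap ℂ L c) = 0)
    (t : L) (hDt : D t = 1)
    (K : Subfield L)
    (hK_const : ∀ c : ℂ, algebraMap ℂ L c ∈ K)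
    (hK_t : t ∈ K)
    (hK_D : ∀ a ∈ K, D a ∈ K)
    (y : L) (hy0 : y ≠ 0) (hy1 : y ≠ 1)
    (hy : D (D y) = (1 / (2 * y) + 1 / (y - 1)) * (D y) ^ 2 - (1 / t) * D y
        + ((y - 1) ^ 2 / t ^ 2) * (algebraMap ℂ L α * y + algebraMap ℂ L β / y)
        + algebraMap ℂ L γ * y / t
        + algebraMap ℂ L δ * y * (y + 1) / (y - 1)) :
    IsAlgebraic K y ∨ AlgebraicIndependent K ![y, D y] := by
  by_contra hcon
  rw [not_or] at hcon
  obtain ⟨htr, hdep⟩ := hcon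
  have hL : CharZero L := charZero_of_injective_algebraMap (algebraMap ℂ L).injective
  have ht : t ≠ 0 := by
    rintro rfl
    have := hD_add 0 0
    simp [hDt] at this
  have hδ : δ ≠ 0 := hind.ne_zero 3
  let DL : Derivation ℤ L L :=
    Derivation.mk' (AddMonoidHom.mk' D hD_add).toIntLinearMap hD_mul
  let θ : Derivation ℤ L L := t • DL
  have hθ : ∀ x, θ x = t * D x := fun _ => rfl
  let τ : K := ⟨t, hK_t⟩
  let d : Derivation ℤ K K :=
    Derivation.mk' (AddMonoidHom.mk' (fun a : K => τ * ⟨D a, hK_D a a.2⟩) fun a b =>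
      Subtype.ext (by
        change t * D (a + b) = t * D a + t * D b
        rw [hD_add, mul_add])).toIntLinearMap fun a b => Subtype.ext (by
        change t * D (a * b) = a * (t * D b) + b * (t * D a)
        rw [hD_mul]
        ring)
  have hd : ∀ a : K, algebraMap K L (d a) = θ (algebraMap K L a) := fun _ => rfl
  let ι : ℂ →+* K := (algebraMap ℂ L).codRestrict K hK_const
  have hι : ∀ a : ℂ, algebraMap K L (ι a) = algebraMap ℂ L a := fun _ => rfl
  have hτ0 : τ ≠ 0 := fun h => ht (congrArg Subtype.val h)
  obtain ⟨s₀, hs₀⟩ := IsAlgClosed.exists_pow_nat_eq (-2 * β) two_pos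
  obtain ⟨s, hs⟩ := IsAlgClosed.exists_pow_nat_eq (2 * α) two_pos
  obtain ⟨κ, hκ⟩ := IsAlgClosed.exists_pow_nat_eq (-2 * δ) two_pos
  have hκ0 : κ ≠ 0 := by
    rintro rfl
    exact hδ (by simpa using hκ)
  obtain ⟨G₀, hG₀, hG₀0⟩ := exists_aevalAeval_eq_zero_of_not_algebraicIndependent hdep
  obtain ⟨G, hG, hG0⟩ := exists_aevalAeval_mul_eq_zero hτ0 hG₀ hG₀0
  have hdc : d (ι κ * τ) = ι κ * τ := by
    refine Subtype.ext ?_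
    change t * D (algebraMap ℂ L κ * t) = algebraMap ℂ L κ * t
    rw [hD_mul, hDt, hD_const]
    ring
  have hz : y * (y - 1) * θ (t * D y) = (3 * y - 1) / 2 * (t * D y) ^ 2 +
      Polynomial.aeval y (painleveVPoly (ι s ^ 2 / 2) (-ι s₀ ^ 2 / 2) (ι γ * τ)
        (-(ι κ * τ) ^ 2 / 2)) := by
    have hy1' : y - 1 ≠ 0 := sub_ne_zero.2 hy1
    have e1 : (ι s ^ 2 / 2 : K) = ι α := by rw [← map_pow, hs, map_mul, map_ofNat]; ring
    have e2 : (-ι s₀ ^ 2 / 2 : K) = ι β := by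
      rw [← map_pow, hs₀, map_mul, map_neg, map_ofNat]; ring
    have e3 : (-(ι κ * τ) ^ 2 / 2 : K) = ι δ * τ ^ 2 := by
      rw [mul_pow, ← map_pow, hκ, map_mul, map_neg, map_ofNat]; ring
    rw [e1, e2, e3, hθ, hD_mul, hDt, hy]
    simp only [painleveVPoly, map_add, map_mul, map_sub, map_pow, Polynomial.aeval_X,
      Polynomial.aeval_C, map_one, hι, show algebraMap K L τ = t from rfl]
    field_simp
    ring
  obtain ⟨N, p, q, r, hN, h⟩ := exists_int_relation hd rfl
    (mul_ne_zero ((map_ne_zero ι).2 hκ0) hτ0) hdc hz htr hG hG0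
  refine natCast_mul_ne_of_algebraicIndependent hind hs₀ hs hκ hN p q r (ι.injective ?_)
  refine mul_right_cancel₀ hτ0 ?_
  simp only [map_mul, map_add, map_natCast, map_intCast]
  linear_combination h
end
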